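/- arXiv:1810.03814 — 10 statements merged into one kernel-verified Lean document; each statement's English description precedes it below -/
import Mathlib

section
/- Let λ > 0 and, for each α > 0, let β̂_{λ,α} be the unique minimizer of the Enet objective J_{λ,α}. Let β̂_λ be the unique element of minimum Euclidean norm of the set M_λ of minimizers of the LASSO objective L_λ (this minimum-norm element is unique since M_λ is nonempty, compact and convex). Then ‖β̂_{λ,α} − β̂_λ‖₂ → 0 as α → 0⁺. -/
open scoped BigOperators

/-- Euclidean norm of a finitely supported real vector. -/
noncomputable def norm2 {ι : Type*} [Fintype ι] (v : ι → ℝ) : ℝ :=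
  Real.sqrt (∑ i, v i ^ 2)

theorem sum_sq_half_add {ι : Type*} [Fintype ι] (a b : ι → ℝ) :
    ∑ i, ((2⁻¹ : ℝ) • (a + b)) i ^ 2 =
      (∑ i, a i ^ 2 + ∑ i, b i ^ 2) / 2 - (∑ i, (a i - b i) ^ 2) / 4 := by
  rw [← Finset.sum_add_distrib, Finset.sum_div, Finset.sum_div, ← Finset.sum_sub_distrib]
  refine Finset.sum_congr rfl fun i _ => ?_
  simp only [Pi.smul_apply, Pi.add_apply, smul_eq_mul]
  ring

theorem sum_abs_half_add_le {ι : Type*} [Fintype ι] (a b : ι → ℝ) :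
    ∑ i, |((2⁻¹ : ℝ) • (a + b)) i| ≤ (∑ i, |a i| + ∑ i, |b i|) / 2 := by
  rw [← Finset.sum_add_distrib, Finset.sum_div]
  refine Finset.sum_le_sum fun i _ => ?_
  simp only [Pi.smul_apply, Pi.add_apply, smul_eq_mul, abs_mul]
  rw [abs_of_pos (by norm_num : (0 : ℝ) < 2⁻¹)]
  linarith [abs_add_le (a i) (b i)]

theorem sum_residual_sq_half_add_le {ι κ : Type*} [Fintype ι] [Fintype κ]
    (X : Matrix ι κ ℝ) (y : ι → ℝ) (a b : κ → ℝ) :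
    ∑ i, (X.mulVec ((2⁻¹ : ℝ) • (a + b)) i - y i) ^ 2 ≤
      (∑ i, (X.mulVec a i - y i) ^ 2 + ∑ i, (X.mulVec b i - y i) ^ 2) / 2 := by
  rw [← Finset.sum_add_distrib, Finset.sum_div]
  refine Finset.sum_le_sum fun i _ => ?_
  simp only [Matrix.mulVec_smul, Matrix.mulVec_add, Pi.smul_apply, Pi.add_apply, smul_eq_mul]
  nlinarith [sq_nonneg (X.mulVec a i - X.mulVec b i)]

theorem continuous_norm2 {ι : Type*} [Fintype ι] : Continuous (norm2 : (ι → ℝ) → ℝ) := by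
  unfold norm2
  fun_prop

theorem isCompact_sum_sq_le {ι : Type*} [Fintype ι] (r : ℝ) :
    IsCompact {b : ι → ℝ | ∑ i, b i ^ 2 ≤ r} := by
  refine (isCompact_Icc (a := fun _ : ι => -Real.sqrt r)
    (b := fun _ => Real.sqrt r)).of_isClosed_subset (isClosed_le (by fun_prop) continuous_const) fun b hb => ?_
  have h (i : ι) : |b i| ≤ Real.sqrt r := Real.abs_le_sqrt <|
    (Finset.single_le_sum (f := fun i => b i ^ 2) (fun _ _ => sq_nonneg _)
      (Finset.mem_univ i)).trans hb
  exact ⟨fun i => (abs_le.mp (h i)).1, fun i => (abs_le.mp (h i)).2⟩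

/-- A midpoint convex function has at most one minimizer of least Euclidean norm. -/
theorem eq_of_minimizer_of_sum_sq_le {ι : Type*} [Fintype ι] {f : (ι → ℝ) → ℝ}
    (hf : ∀ a b, f ((2⁻¹ : ℝ) • (a + b)) ≤ (f a + f b) / 2) {x z : ι → ℝ}
    (hz : ∀ b, f z ≤ f b) (hzmin : ∀ b, (∀ c, f b ≤ f c) → norm2 z ≤ norm2 b)
    (hx : f x ≤ f z) (hxz : ∑ i, x i ^ 2 ≤ ∑ i, z i ^ 2) : x = z := by
  have hmid := hzmin ((2⁻¹ : ℝ) • (x + z)) fun c => by linarith [hf x z, hz c]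
  have hle := (Real.sqrt_le_sqrt_iff (Finset.sum_nonneg fun _ _ => sq_nonneg _)).mp hmid
  rw [sum_sq_half_add] at hle
  have hzero : ∑ i, (x i - z i) ^ 2 = 0 :=
    le_antisymm (by linarith) (Finset.sum_nonneg fun _ _ => sq_nonneg _)
  funext i
  have hi := (Finset.sum_eq_zero_iff_of_nonneg fun _ _ => sq_nonneg _).mp hzero i
    (Finset.mem_univ i)
  exact sub_eq_zero.mp (pow_eq_zero_iff two_ne_zero |>.mp hi)

/-- Tikhonov regularization: minimizers of `f + α c ‖·‖₂²` converge to the minimizer of `f` of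
least Euclidean norm as `α → 0⁺`. -/
theorem tendsto_regularized_minimizer {ι : Type*} [Fintype ι] {f : (ι → ℝ) → ℝ}
    (hcont : Continuous f) (hf : ∀ a b, f ((2⁻¹ : ℝ) • (a + b)) ≤ (f a + f b) / 2)
    {c : ℝ} (hc : 0 < c) {u : ℝ → ι → ℝ}
    (hu : ∀ α : ℝ, 0 < α → ∀ b,
      f (u α) + α * c * ∑ i, u α i ^ 2 ≤ f b + α * c * ∑ i, b i ^ 2)
    {z : ι → ℝ} (hz : ∀ b, f z ≤ f b)
    (hzmin : ∀ b, (∀ c, f b ≤ f c) → norm2 z ≤ norm2 b) :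
    Filter.Tendsto u (nhdsWithin 0 (Set.Ioi 0)) (nhds z) := by
  have hpos : ∀ᶠ α : ℝ in nhdsWithin 0 (Set.Ioi 0), 0 < α := self_mem_nhdsWithin
  have hbound : ∀ᶠ α : ℝ in nhdsWithin 0 (Set.Ioi 0), u α ∈ {b | ∑ i, b i ^ 2 ≤ ∑ i, z i ^ 2} := by
    filter_upwards [hpos] with α hα
    exact le_of_mul_le_mul_left (by linarith [hu α hα z, hz (u α)]) (mul_pos hα hc)
  have hlim : Filter.Tendsto (fun α : ℝ => f z + α * c * ∑ i, z i ^ 2)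
      (nhdsWithin 0 (Set.Ioi 0)) (nhds (f z)) := by
    have h : Continuous fun α : ℝ => f z + α * c * ∑ i, z i ^ 2 := by fun_prop
    simpa using (h.tendsto 0).mono_left nhdsWithin_le_nhds
  refine (isCompact_sum_sq_le _).tendsto_nhds_of_unique_mapClusterPt hbound fun x hx hcl => ?_
  refine eq_of_minimizer_of_sum_sq_le hf hz hzmin (le_of_forall_gt_imp_ge_of_dense fun r hr => ?_) hx
  by_contra! hlt
  obtain ⟨α, hα, hαpos, hαr⟩ := ((hcl.frequently
    (hcont.continuousAt.eventually (eventually_gt_nhds hlt))).and_eventually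
    (hpos.and (hlim.eventually (eventually_lt_nhds hr)))).exists
  have hnonneg : 0 ≤ α * c * ∑ i, u α i ^ 2 :=
    mul_nonneg (mul_pos hαpos hc).le (Finset.sum_nonneg fun _ _ => sq_nonneg _)
  linarith [hu α hαpos z]

/-- the unique Enet minimizers β̂_{λ,α} converge (in Euclidean norm)
to the minimum-norm LASSO solution β̂_λ as α → 0⁺. -/
theorem stmt_2 (n p : ℕ) (hn : 0 < n) (X : Matrix (Fin n) (Fin p) ℝ) (y : Fin n → ℝ)
    (lam : ℝ) (hlam : 0 < lam)
    (L : (Fin p → ℝ) → ℝ)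
    (hL : L = fun β =>
      (1 / (2 * (n : ℝ))) * ∑ i, (X.mulVec β i - y i) ^ 2 + lam * ∑ j, |β j|)
    (J : ℝ → (Fin p → ℝ) → ℝ)
    (hJ : J = fun α β => L β + (α / (2 * (n : ℝ))) * ∑ j, β j ^ 2)
    (βE : ℝ → Fin p → ℝ)
    (hE : ∀ α : ℝ, 0 < α → ∀ b, J α (βE α) ≤ J α b)
    (βL : Fin p → ℝ)
    (hβL : ∀ b, L βL ≤ L b)
    (hβLmin : ∀ b, (∀ c, L b ≤ L c) → norm2 βL ≤ norm2 b) :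
    Filter.Tendsto (fun α : ℝ => norm2 (βE α - βL)) (nhdsWithin 0 (Set.Ioi 0)) (nhds 0) := by
  have hc : (0 : ℝ) < 1 / (2 * (n : ℝ)) := by positivity
  have hcont : Continuous L := by
    have hX : Continuous fun β : Fin p → ℝ => X.mulVec β :=
      continuous_const.matrix_mulVec continuous_id
    have hXi (i : Fin n) : Continuous fun β : Fin p → ℝ => X.mulVec β i :=
      (continuous_apply i).comp hX
    rw [hL]
    fun_prop
  have hmid (a b : Fin p → ℝ) : L ((2⁻¹ : ℝ) • (a + b)) ≤ (L a + L b) / 2 := by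
    rw [hL]
    linarith [mul_le_mul_of_nonneg_left (sum_residual_sq_half_add_le X y a b) hc.le,
      mul_le_mul_of_nonneg_left (sum_abs_half_add_le a b) hlam.le]
  have hE' (α : ℝ) (hα : 0 < α) (b : Fin p → ℝ) :
      L (βE α) + α * (1 / (2 * (n : ℝ))) * ∑ j, βE α j ^ 2 ≤
        L b + α * (1 / (2 * (n : ℝ))) * ∑ j, b j ^ 2 := by
    simpa [hJ, div_eq_mul_inv] using hE α hα b
  have hβE := tendsto_regularized_minimizer hcont hmid hc hE' hβL hβLmin
  have h := ((continuous_norm2.comp (continuous_sub_right βL)).tendsto βL).comp hβE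
  simpa [norm2, Function.comp_def] using h
end

section
/- Let λ > 0, α > 0, G = XᵀX + αI and ỹ = Xᵀy. If β̂ ∈ ℝ^p is the (unique) minimizer of the Enet objective J_{λ,α}, then the vector d̂ = (ỹ − Gβ̂)/n satisfies β̂ = T_λ(β̂ + d̂), where T_λ is the componentwise soft-threshold operator. -/
open scoped BigOperators
open Matrix

/-- Componentwise soft-threshold operator. -/
noncomputable def softThresh (lam : ℝ) {ι : Type*} (x : ι → ℝ) : ι → ℝ :=
  fun i => x i - |x i + lam| / 2 + |x i - lam| / 2

/-- First-order optimality: the quadratic term does not matter at a minimizer of a perturbed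
absolute value. -/
lemma mul_le_of_forall_quadratic_perturbation {lam d b C : ℝ} (hlam : 0 ≤ lam)
    (h : ∀ t : ℝ, t * d ≤ lam * (|b + t| - |b|) + C * t ^ 2) (u : ℝ) :
    u * d ≤ lam * (|b + u| - |b|) := by
  have hs : ∀ s : ℝ, 0 < s → s ≤ 1 → u * d ≤ lam * (|b + u| - |b|) + s * (C * u ^ 2) := by
    intro s hs0 hs1
    have habs : |b + s * u| ≤ (1 - s) * |b| + s * |b + u| := by
      calc |b + s * u| = |(1 - s) * b + s * (b + u)| := by ring_nf
        _ ≤ |(1 - s) * b| + |s * (b + u)| := abs_add_le _ _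
        _ = (1 - s) * |b| + s * |b + u| := by
          rw [abs_mul, abs_mul, abs_of_nonneg (sub_nonneg.2 hs1), abs_of_pos hs0]
    refine le_of_mul_le_mul_left ?_ hs0
    have := mul_le_mul_of_nonneg_left habs hlam
    linarith [h (s * u)]
  have hlim : Filter.Tendsto (fun s : ℝ => lam * (|b + u| - |b|) + s * (C * u ^ 2))
      (nhdsWithin 0 (Set.Ioi 0)) (nhds (lam * (|b + u| - |b|))) := by
    have hc : Continuous fun s : ℝ => lam * (|b + u| - |b|) + s * (C * u ^ 2) := by fun_prop
    simpa using (hc.tendsto 0).mono_left nhdsWithin_le_nhds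
  refine ge_of_tendsto hlim ?_
  filter_upwards [Ioc_mem_nhdsGT (zero_lt_one' ℝ)] with s hs'
  exact hs s hs'.1 hs'.2

/-- A subgradient `d` of `lam * |·|` at `b` satisfies the soft-threshold fixed point equation. -/
lemma eq_soft_threshold_of_subgradient {lam d b : ℝ} (hlam : 0 < lam)
    (h : ∀ u : ℝ, u * d ≤ lam * (|b + u| - |b|)) :
    b = b + d - |b + d + lam| / 2 + |b + d - lam| / 2 := by
  have hd : d ≤ lam := by
    have h1 := abs_add_le b 1
    rw [abs_one] at h1
    nlinarith [h 1]
  have hd' : -lam ≤ d := by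
    have h1 := abs_add_le b (-1)
    rw [abs_neg, abs_one] at h1
    nlinarith [h (-1)]
  have hb := h (-b)
  rw [add_neg_cancel, abs_zero] at hb
  rcases lt_trichotomy b 0 with hb0 | rfl | hb0
  · rw [abs_of_neg hb0] at hb
    have : d = -lam := le_antisymm (by nlinarith) hd'
    subst this
    rw [abs_of_nonpos (by linarith), abs_of_nonpos (by linarith)]
    ring
  · rw [abs_of_nonneg (by linarith), abs_of_nonpos (by linarith)]
    ring
  · rw [abs_of_pos hb0] at hb
    have : d = lam := le_antisymm hd (by nlinarith)
    subst this
    rw [abs_of_nonneg (by linarith), abs_of_nonneg (by linarith)]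
    ring

lemma sum_comp_add_single {ι : Type*} [Fintype ι] [DecidableEq ι] (f : ℝ → ℝ) (b : ι → ℝ)
    (j : ι) (t : ℝ) :
    ∑ k, f ((b + Pi.single j t : ι → ℝ) k) = ∑ k, f (b k) + (f (b j + t) - f (b j)) := by
  rw [← sub_eq_iff_eq_add', ← Finset.sum_sub_distrib, Finset.sum_eq_single j]
  · simp
  · intro k _ hk
    simp [hk]
  · simp

lemma sum_sq_mulVec_add_single_sub {m ι : Type*} [Fintype m] [Fintype ι] [DecidableEq ι]
    (X : Matrix m ι ℝ) (y : m → ℝ) (b : ι → ℝ) (j : ι) (t : ℝ) :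
    ∑ i, (X.mulVec (b + Pi.single j t) i - y i) ^ 2 =
      ∑ i, (X.mulVec b i - y i) ^ 2 + 2 * t * ∑ i, X i j * (X.mulVec b i - y i)
        + t ^ 2 * ∑ i, X i j ^ 2 := by
  rw [Finset.mul_sum, Finset.mul_sum, ← Finset.sum_add_distrib, ← Finset.sum_add_distrib]
  refine Finset.sum_congr rfl fun i _ => ?_
  simp only [mulVec_add, Pi.add_apply, mulVec_single, Pi.smul_apply, MulOpposite.smul_eq_mul_unop,
    MulOpposite.unop_op, col_apply]
  ring

lemma residual_correlation {m ι : Type*} [Fintype m] [Fintype ι] [DecidableEq ι]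
    (X : Matrix m ι ℝ) (y : m → ℝ) (α : ℝ) (b : ι → ℝ) (j : ι) :
    Xᵀ.mulVec y j - (Xᵀ * X + α • (1 : Matrix ι ι ℝ)).mulVec b j =
      -(∑ i, X i j * (X.mulVec b i - y i)) - α * b j := by
  simp only [add_mulVec, ← mulVec_mulVec, smul_mulVec, one_mulVec, Pi.add_apply, Pi.smul_apply,
    smul_eq_mul, mul_sub, Finset.sum_sub_distrib]
  simp only [mulVec, dotProduct, transpose_apply]
  ring

/-- if β̂ minimizes the Enet objective then, with G = XᵀX + αI,
ỹ = Xᵀy and d̂ = (ỹ − Gβ̂)/n, we have β̂ = T_λ(β̂ + d̂). -/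
theorem stmt_3 (n p : ℕ) (hn : 0 < n) (X : Matrix (Fin n) (Fin p) ℝ) (y : Fin n → ℝ)
    (lam α : ℝ) (hlam : 0 < lam) (hα : 0 < α)
    (βhat : Fin p → ℝ)
    (hmin : ∀ b : Fin p → ℝ,
      (1 / (2 * (n : ℝ))) * ∑ i, (X.mulVec βhat i - y i) ^ 2 + lam * ∑ j, |βhat j|
        + (α / (2 * (n : ℝ))) * ∑ j, βhat j ^ 2 ≤
      (1 / (2 * (n : ℝ))) * ∑ i, (X.mulVec b i - y i) ^ 2 + lam * ∑ j, |b j|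
        + (α / (2 * (n : ℝ))) * ∑ j, b j ^ 2) :
    let G := Xᵀ * X + α • (1 : Matrix (Fin p) (Fin p) ℝ)
    let ytil := Xᵀ.mulVec y
    let dhat : Fin p → ℝ := fun j => (ytil j - G.mulVec βhat j) / n
    βhat = softThresh lam (βhat + dhat) := by
  intro G ytil dhat
  have hn' : (0 : ℝ) < n := Nat.cast_pos.2 hn
  funext j
  refine eq_soft_threshold_of_subgradient hlam
    (mul_le_of_forall_quadratic_perturbation (C := (∑ i, X i j ^ 2 + α) / (2 * n)) hlam.le
      fun t => ?_)
  have h := hmin (βhat + Pi.single j t)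
  rw [sum_sq_mulVec_add_single_sub, sum_comp_add_single (fun x => |x|),
    sum_comp_add_single (fun x => x ^ 2)] at h
  have hd : dhat j = (-(∑ i, X i j * (X.mulVec βhat i - y i)) - α * βhat j) / n :=
    congrArg (· / (n : ℝ)) (residual_correlation X y α βhat j)
  rw [hd, ← sub_nonneg]
  rw [← sub_nonneg] at h
  refine h.trans_eq ?_
  field_simp
  ring
end

section
/- Let λ > 0, α > 0, G = XᵀX + αI and ỹ = Xᵀy. If β̂, d̂ ∈ ℝ^p satisfy d̂ = (ỹ − Gβ̂)/n and β̂ = T_λ(β̂ + d̂), where T_λ is the componentwise soft-threshold operator, then β̂ is the unique minimizer of the Enet objective J_{λ,α} over ℝ^p. -/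
open scoped BigOperators
open Matrix

/-- A fixed point of the scalar soft-threshold equation yields a subgradient of `lam * |·|`. -/
theorem softThresh_fixed_subgradient {lam b d : ℝ} (hlam : 0 ≤ lam)
    (h : b = b + d - |b + d + lam| / 2 + |b + d - lam| / 2) (c : ℝ) :
    lam * |b| + d * (c - b) ≤ lam * |c| := by
  have key : |d| ≤ lam ∧ d * b = lam * |b| := by
    rcases le_total lam (b + d) with h1 | h1
    · rw [abs_of_nonneg (by linarith : 0 ≤ b + d + lam),
        abs_of_nonneg (by linarith : 0 ≤ b + d - lam)] at h
      have hd : d = lam := by linarith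
      have hb : 0 ≤ b := by linarith
      rw [hd, abs_of_nonneg hb, abs_of_nonneg hlam]
      exact ⟨le_rfl, rfl⟩
    · rcases le_total (b + d) (-lam) with h2 | h2
      · rw [abs_of_nonpos (by linarith : b + d + lam ≤ 0),
          abs_of_nonpos (by linarith : b + d - lam ≤ 0)] at h
        have hd : d = -lam := by linarith
        have hb : b ≤ 0 := by linarith
        rw [hd, abs_of_nonpos hb, abs_neg, abs_of_nonneg hlam]
        exact ⟨le_rfl, by ring⟩
      · rw [abs_of_nonneg (by linarith : 0 ≤ b + d + lam),
          abs_of_nonpos (by linarith : b + d - lam ≤ 0)] at h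
        have hb : b = 0 := by linarith
        subst hb
        exact ⟨abs_le.mpr ⟨by linarith, by linarith⟩, by simp⟩
  have hdc : d * c ≤ lam * |c| :=
    (le_abs_self _).trans ((abs_mul d c).le.trans
      (mul_le_mul_of_nonneg_right key.1 (abs_nonneg c)))
  linarith [key.2]

/-- The residual `Xᵀ y - (Xᵀ X + α I) β` paired with `v` is minus the derivative at `β`, in
direction `v`, of half the ridge objective. -/
theorem ridge_residual_dotProduct {m k : Type*} [Fintype m] [Fintype k] [DecidableEq k]
    (X : Matrix m k ℝ) (y : m → ℝ) (α : ℝ) (β v : k → ℝ) :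
    (Xᵀ *ᵥ y - (Xᵀ * X + α • (1 : Matrix k k ℝ)) *ᵥ β) ⬝ᵥ v
      = -((X *ᵥ β - y) ⬝ᵥ (X *ᵥ v)) - α * (β ⬝ᵥ v) := by
  have hT (z : m → ℝ) : (Xᵀ *ᵥ z) ⬝ᵥ v = z ⬝ᵥ (X *ᵥ v) := by
    rw [mulVec_transpose, dotProduct_mulVec]
  rw [add_mulVec, smul_mulVec, one_mulVec, ← mulVec_mulVec, sub_dotProduct, add_dotProduct,
    smul_dotProduct, hT, hT, sub_dotProduct, smul_eq_mul]
  ring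

/-- if β̂, d̂ satisfy the KKT equations d̂ = (ỹ − Gβ̂)/n and
β̂ = T_λ(β̂ + d̂), then β̂ is the unique minimizer of the Enet objective. -/
theorem stmt_4 (n p : ℕ) (hn : 0 < n) (X : Matrix (Fin n) (Fin p) ℝ) (y : Fin n → ℝ)
    (lam α : ℝ) (hlam : 0 < lam) (hα : 0 < α)
    (βhat dhat : Fin p → ℝ)
    (hd : dhat = fun j =>
      (Xᵀ.mulVec y j - (Xᵀ * X + α • (1 : Matrix (Fin p) (Fin p) ℝ)).mulVec βhat j) / n)
    (hkkt : βhat = softThresh lam (βhat + dhat)) :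
    let J : (Fin p → ℝ) → ℝ := fun β =>
      (1 / (2 * (n : ℝ))) * ∑ i, (X.mulVec β i - y i) ^ 2 + lam * ∑ j, |β j|
        + (α / (2 * (n : ℝ))) * ∑ j, β j ^ 2
    (∀ b, J βhat ≤ J b) ∧ ∀ b, (∀ c, J b ≤ J c) → b = βhat := by
  intro J
  have hn' : (0 : ℝ) < n := Nat.cast_pos.mpr hn
  have growth (b : Fin p → ℝ) :
      J βhat + α / (2 * (n : ℝ)) * ∑ j, (b j - βhat j) ^ 2 ≤ J b := by
    have hsub : lam * ∑ j, |βhat j| + ∑ j, dhat j * (b j - βhat j) ≤ lam * ∑ j, |b j| := by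
      rw [Finset.mul_sum, Finset.mul_sum, ← Finset.sum_add_distrib]
      exact Finset.sum_le_sum fun j _ =>
        softThresh_fixed_subgradient hlam.le (congrFun hkkt j) (b j)
    have hres : ∑ j, dhat j * (b j - βhat j)
        = (-(∑ i, (X.mulVec βhat i - y i) * X.mulVec (b - βhat) i)
          - α * ∑ j, βhat j * (b j - βhat j)) / n := by
      have h := ridge_residual_dotProduct X y α βhat (b - βhat)
      simp only [dotProduct, Pi.sub_apply] at h
      rw [← h, hd, Finset.sum_div]
      exact Finset.sum_congr rfl fun j _ => by ring
    have hfit : ∑ i, (X.mulVec b i - y i) ^ 2 = ∑ i, (X.mulVec βhat i - y i) ^ 2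
        + 2 * ∑ i, (X.mulVec βhat i - y i) * X.mulVec (b - βhat) i
        + ∑ i, X.mulVec (b - βhat) i ^ 2 := by
      rw [Finset.mul_sum, ← Finset.sum_add_distrib, ← Finset.sum_add_distrib]
      refine Finset.sum_congr rfl fun i _ => ?_
      rw [mulVec_sub, Pi.sub_apply]
      ring
    have hridge : ∑ j, b j ^ 2 = ∑ j, βhat j ^ 2 + 2 * ∑ j, βhat j * (b j - βhat j)
        + ∑ j, (b j - βhat j) ^ 2 := by
      rw [Finset.mul_sum, ← Finset.sum_add_distrib, ← Finset.sum_add_distrib]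
      exact Finset.sum_congr rfl fun j _ => by ring
    have hpos : 0 ≤ 1 / (2 * (n : ℝ)) * ∑ i, X.mulVec (b - βhat) i ^ 2 := by positivity
    rw [hres] at hsub
    simp only [J]
    rw [hfit, hridge]
    field_simp at hsub hpos ⊢
    linarith
  refine ⟨fun b => le_trans (le_add_of_nonneg_right (by positivity)) (growth b),
    fun b hb => ?_⟩
  have hle : α / (2 * (n : ℝ)) * ∑ j, (b j - βhat j) ^ 2 ≤ 0 := by
    linarith [growth b, hb βhat]
  have hzero : ∑ j, (b j - βhat j) ^ 2 = 0 :=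
    le_antisymm (nonpos_of_mul_nonpos_right hle (by positivity))
      (Finset.sum_nonneg fun j _ => sq_nonneg _)
  funext j
  have hj := (Finset.sum_eq_zero_iff_of_nonneg fun j _ => sq_nonneg (b j - βhat j)).mp hzero j
    (Finset.mem_univ j)
  exact sub_eq_zero.mp (pow_eq_zero_iff two_ne_zero |>.mp hj)
end

section
/- Let λ > 0. A vector β̂ ∈ ℝ^p minimizes the LASSO objective L_λ(β) = (1/(2n))‖Xβ − y‖₂² + λ‖β‖₁ if and only if β̂ = T_λ(β̂ + d̂), where d̂ = Xᵀ(y − Xβ̂)/n and T_λ is the componentwise soft-threshold operator. -/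
open scoped BigOperators
open Matrix

/-- A fixed point `b` of `T_lam (· + d)` is a point where `d` is a subgradient of `lam * |·|`. -/
theorem eq_softThresh_scalar_iff {lam : ℝ} (hlam : 0 < lam) (b d : ℝ) :
    b = b + d - |b + d + lam| / 2 + |b + d - lam| / 2 ↔
      ∀ t, d * t ≤ lam * (|b + t| - |b|) := by
  constructor
  · intro h t
    have bounds : |d| ≤ lam ∧ d * b = lam * |b| := by
      rcases abs_cases (b + d + lam) with ⟨h₁, _⟩ | ⟨h₁, _⟩ <;>
      rcases abs_cases (b + d - lam) with ⟨h₂, _⟩ | ⟨h₂, _⟩ <;>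
      rw [h₁, h₂] at h
      · obtain rfl : d = lam := by linarith
        rw [abs_of_pos hlam, abs_of_nonneg (by linarith : 0 ≤ b)]
        exact ⟨le_rfl, rfl⟩
      · obtain rfl : b = 0 := by linarith
        refine ⟨abs_le.2 ⟨by linarith, by linarith⟩, by simp⟩
      · linarith
      · obtain rfl : d = -lam := by linarith
        rw [abs_neg, abs_of_pos hlam, abs_of_nonpos (by linarith : b ≤ 0)]
        exact ⟨le_rfl, by ring⟩
    have hle : d * (b + t) ≤ lam * |b + t| :=
      (le_abs_self _).trans <| by
        rw [abs_mul]
        exact mul_le_mul_of_nonneg_right bounds.1 (abs_nonneg _)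
    linarith [bounds.2]
  · intro h
    rcases lt_trichotomy b 0 with hb | rfl | hb
    · have h₁ := h b
      have h₂ := h (-b)
      rw [← two_mul, abs_mul, abs_two, abs_of_neg hb] at h₁
      rw [add_neg_cancel, abs_zero, abs_of_neg hb] at h₂
      obtain rfl : d = -lam := mul_right_cancel₀ hb.ne (by linarith)
      rw [abs_of_neg (by linarith : b + -lam + lam < 0),
        abs_of_neg (by linarith : b + -lam - lam < 0)]
      ring
    · have h₁ := h 1
      have h₂ := h (-1)
      norm_num at h₁ h₂
      rw [abs_of_nonneg (by linarith : 0 ≤ 0 + d + lam),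
        abs_of_nonpos (by linarith : 0 + d - lam ≤ 0)]
      ring
    · have h₁ := h b
      have h₂ := h (-b)
      rw [← two_mul, abs_mul, abs_two, abs_of_pos hb] at h₁
      rw [add_neg_cancel, abs_zero, abs_of_pos hb] at h₂
      obtain rfl : d = lam := mul_right_cancel₀ hb.ne' (by linarith)
      rw [abs_of_pos (by linarith : 0 < b + d + d),
        abs_of_pos (by linarith : 0 < b + d - d)]
      ring

/-- Expansion of the LASSO objective around `β`. -/
theorem lasso_add {n p : ℕ} (X : Matrix (Fin n) (Fin p) ℝ) (y : Fin n → ℝ)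
    (lam : ℝ) (β h : Fin p → ℝ) :
    (1 / (2 * (n : ℝ))) * ∑ i, (X.mulVec (β + h) i - y i) ^ 2 + lam * ∑ j, |(β + h) j| =
      (1 / (2 * (n : ℝ))) * ∑ i, (X.mulVec β i - y i) ^ 2 + lam * ∑ j, |β j| +
        ((1 / (2 * (n : ℝ))) * ∑ i, (X.mulVec h i) ^ 2 +
          ∑ j, (lam * (|β j + h j| - |β j|) -
            (∑ i, X i j * (y i - X.mulVec β i)) / n * h j)) := by
  have cross : ∑ j, (∑ i, X i j * (y i - X.mulVec β i)) / n * h j =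
      (1 / (n : ℝ)) * ∑ i, (y i - X.mulVec β i) * X.mulVec h i := by
    simp only [Matrix.mulVec, dotProduct, Finset.mul_sum, Finset.sum_div, Finset.sum_mul]
    rw [Finset.sum_comm]
    refine Finset.sum_congr rfl fun i _ => Finset.sum_congr rfl fun j _ => ?_
    ring
  have square : ∑ i, (X.mulVec (β + h) i - y i) ^ 2 =
      ∑ i, (X.mulVec β i - y i) ^ 2 + ∑ i, (X.mulVec h i) ^ 2 -
        2 * ∑ i, (y i - X.mulVec β i) * X.mulVec h i := by
    rw [Finset.mul_sum, ← Finset.sum_add_distrib, ← Finset.sum_sub_distrib]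
    refine Finset.sum_congr rfl fun i _ => ?_
    rw [Matrix.mulVec_add, Pi.add_apply]
    ring
  rw [Finset.sum_sub_distrib, cross, square, ← Finset.mul_sum, Finset.sum_sub_distrib]
  simp only [Pi.add_apply]
  ring

/-- If `A + s * C` is nonnegative for all `s ∈ (0, 1]`, then so is `A`. -/
theorem nonneg_of_forall_add_mul_nonneg {A C : ℝ}
    (h : ∀ s, 0 < s → s ≤ 1 → 0 ≤ A + s * C) : 0 ≤ A := by
  have lim : Filter.Tendsto (fun s : ℝ => A + s * C) (nhdsWithin 0 (Set.Ioi 0)) (nhds A) := by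
    have : Continuous fun s : ℝ => A + s * C := by fun_prop
    simpa using (this.tendsto 0).mono_left nhdsWithin_le_nhds
  refine ge_of_tendsto lim ?_
  filter_upwards [Ioc_mem_nhdsGT (zero_lt_one' ℝ)] with s hs using h s hs.1 hs.2

theorem abs_add_mul_sub_abs_le {s : ℝ} (hs : 0 ≤ s) (hs1 : s ≤ 1) (b t : ℝ) :
    |b + s * t| - |b| ≤ s * (|b + t| - |b|) := by
  have h := abs_add_le ((1 - s) * b) (s * (b + t))
  rw [abs_mul, abs_mul, abs_of_nonneg hs, abs_of_nonneg (sub_nonneg.2 hs1),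
    show (1 - s) * b + s * (b + t) = b + s * t by ring] at h
  linarith

/-- β̂ minimizes the LASSO objective iff β̂ = T_λ(β̂ + d̂) with
d̂ = Xᵀ(y − Xβ̂)/n. -/
theorem stmt_5 (n p : ℕ) (hn : 0 < n) (X : Matrix (Fin n) (Fin p) ℝ) (y : Fin n → ℝ)
    (lam : ℝ) (hlam : 0 < lam) (βhat : Fin p → ℝ) :
    let L : (Fin p → ℝ) → ℝ := fun β =>
      (1 / (2 * (n : ℝ))) * ∑ i, (X.mulVec β i - y i) ^ 2 + lam * ∑ j, |β j|
    let dhat : Fin p → ℝ := fun j => (∑ i, X i j * (y i - X.mulVec βhat i)) / n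
    (∀ b, L βhat ≤ L b) ↔ βhat = softThresh lam (βhat + dhat) := by
  intro L dhat
  have expand (h : Fin p → ℝ) : L (βhat + h) = L βhat +
      ((1 / (2 * (n : ℝ))) * ∑ i, (X.mulVec h i) ^ 2 +
        ∑ j, (lam * (|βhat j + h j| - |βhat j|) - dhat j * h j)) :=
    lasso_add X y lam βhat h
  have fixed_iff : βhat = softThresh lam (βhat + dhat) ↔
      ∀ j t, dhat j * t ≤ lam * (|βhat j + t| - |βhat j|) := by
    rw [funext_iff]
    exact forall_congr' fun j => eq_softThresh_scalar_iff hlam (βhat j) (dhat j)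
  rw [fixed_iff]
  constructor
  · intro hmin j t
    have key : 0 ≤ lam * (|βhat j + t| - |βhat j|) - dhat j * t := by
      refine nonneg_of_forall_add_mul_nonneg
        (C := (1 / (2 * (n : ℝ))) * ∑ i, (X i j * t) ^ 2) fun s hs hs1 => ?_
      have h := hmin (βhat + Pi.single j (s * t))
      rw [expand, le_add_iff_nonneg_right, Finset.sum_eq_single j
        (fun k _ hk => by simp [Pi.single_eq_of_ne hk]) (by simp)] at h
      have square : ∑ i, (X.mulVec (Pi.single j (s * t)) i) ^ 2 =
          s ^ 2 * ∑ i, (X i j * t) ^ 2 := by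
        rw [Finset.mul_sum]
        refine Finset.sum_congr rfl fun i _ => ?_
        rw [Matrix.mulVec, dotProduct_single]
        ring
      rw [square, Pi.single_eq_same] at h
      have convex := mul_le_mul_of_nonneg_left
        (abs_add_mul_sub_abs_le hs.le hs1 (βhat j) t) hlam.le
      refine nonneg_of_mul_nonneg_right (a := s) ?_ hs
      linarith
    linarith
  · intro hsub b
    rw [← add_sub_cancel βhat b, expand, le_add_iff_nonneg_right]
    refine add_nonneg (by positivity) (Finset.sum_nonneg fun j _ => ?_)
    exact sub_nonneg.2 (hsub j _)
end

section
/- Let λ > 0 and let T_λ : ℝ^p → ℝ^p be the componentwise soft-threshold operator. For w ∈ ℝ^p let D_w : ℝ^p → ℝ^p be the diagonal linear map (D_w h)_i = h_i if |w_i| > λ and (D_w h)_i = 0 otherwise. Then T_λ is Newton differentiable at every x ∈ ℝ^p with Newton derivative D: for every ε > 0 there exists δ > 0 such that for all h ∈ ℝ^p with 0 < ‖h‖₂ < δ one has ‖T_λ(x + h) − T_λ(x) − D_{x+h} h‖₂ ≤ ε‖h‖₂. -/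
open scoped BigOperators

/-- The scalar soft-threshold is affine on each piece, so its Newton remainder vanishes for small
increments. -/
theorem exists_pos_softThresh_remainder_eq_zero {lam : ℝ} (hlam : 0 < lam) (a : ℝ) :
    ∃ δ : ℝ, 0 < δ ∧ ∀ t : ℝ, |t| < δ →
      (a + t - |a + t + lam| / 2 + |a + t - lam| / 2) - (a - |a + lam| / 2 + |a - lam| / 2) -
        (if lam < |a + t| then t else 0) = 0 := by
  by_cases ha : |a| = lam
  · refine ⟨lam, hlam, fun t ht => ?_⟩
    grind
  · refine ⟨|(|a| - lam)|, abs_pos.mpr (sub_ne_zero.mpr ha), fun t ht => ?_⟩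
    grind

theorem abs_le_norm2 {ι : Type*} [Fintype ι] (v : ι → ℝ) (i : ι) : |v i| ≤ norm2 v :=
  Real.abs_le_sqrt (Finset.single_le_sum (f := fun j => v j ^ 2)
    (fun j _ => sq_nonneg (v j)) (Finset.mem_univ i))

/-- the soft-threshold operator T_λ is Newton differentiable at every
x ∈ ℝ^p, with Newton derivative the diagonal map D_w keeping the coordinates where
|w_i| > λ. -/
theorem stmt_6 (p : ℕ) (lam : ℝ) (hlam : 0 < lam) (x : Fin p → ℝ) :
    ∀ ε : ℝ, 0 < ε → ∃ δ : ℝ, 0 < δ ∧ ∀ h : Fin p → ℝ,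
      0 < norm2 h → norm2 h < δ →
      norm2 (fun i =>
          softThresh lam (x + h) i - softThresh lam x i -
            (if lam < |x i + h i| then h i else 0)) ≤ ε * norm2 h := by
  intro ε hε
  choose d hd hzero using fun i => exists_pos_softThresh_remainder_eq_zero hlam (x i)
  have hev : ∀ᶠ δ in nhdsWithin (0 : ℝ) (Set.Ioi 0), ∀ i, δ < d i :=
    Filter.eventually_all.mpr fun i => nhdsWithin_le_nhds (eventually_lt_nhds (hd i))
  obtain ⟨δ, hδ, hδ0⟩ := (hev.and self_mem_nhdsWithin).exists
  refine ⟨δ, hδ0, fun h hpos hh => ?_⟩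
  have hrem : (fun i => softThresh lam (x + h) i - softThresh lam x i -
      (if lam < |x i + h i| then h i else 0)) = 0 := by
    funext i
    exact hzero i (h i) (((abs_le_norm2 h i).trans_lt hh).trans (hδ i))
  rw [hrem]
  simpa [norm2] using (mul_pos hε hpos).le
end

section
/- Let λ > 0, α ≥ 0, G = XᵀX + αI, ỹ = Xᵀy, and define F : ℝ^p × ℝ^p → ℝ^p × ℝ^p by F(β, d) = (β − T_λ(β + d), Gβ + n d − ỹ), where T_λ is the componentwise soft-threshold operator. For w = (u, v) ∈ ℝ^p × ℝ^p let H(w) be the linear map (h_β, h_d) ↦ (h_β − D_{u+v}(h_β + h_d), G h_β + n h_d), where (D_z h)_i = h_i if |z_i| > λ and 0 otherwise. Then F is Newton differentiable at every point z ∈ ℝ^p × ℝ^p with Newton derivative H: ‖F(z + h) − F(z) − H(z + h) h‖₂ = o(‖h‖₂) as ‖h‖₂ → 0, i.e., for every ε > 0 there is δ > 0 such that 0 < ‖h‖₂ < δ implies ‖F(z + h) − F(z) − H(z + h) h‖₂ ≤ ε‖h‖₂. -/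
open scoped BigOperators
open Matrix

/-- Euclidean norm on pairs of vectors (ℝ^p × ℝ^p ≅ ℝ^{2p}). -/
noncomputable def pairNorm {p : ℕ} (z : (Fin p → ℝ) × (Fin p → ℝ)) : ℝ :=
  Real.sqrt (∑ i, z.1 i ^ 2 + ∑ i, z.2 i ^ 2)

/-- Locally around any `t`, the increments of the scalar soft-threshold function agree with its
generalized derivative, evaluated at the perturbed point. -/
theorem exists_softThresh_increment_eq {lam : ℝ} (hlam : 0 < lam) (t : ℝ) :
    ∃ δ : ℝ, 0 < δ ∧ ∀ s : ℝ, |s| < δ →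
      (t + s - |t + s + lam| / 2 + |t + s - lam| / 2) - (t - |t + lam| / 2 + |t - lam| / 2) =
        if lam < |t + s| then s else 0 := by
  by_cases ht : |t| = lam
  · refine ⟨lam, hlam, fun s hs => ?_⟩
    grind
  · refine ⟨|(|t| - lam)|, abs_pos.2 (sub_ne_zero.2 ht), fun s hs => ?_⟩
    grind

theorem abs_fst_add_snd_le_two_mul_pairNorm {p : ℕ} (h : (Fin p → ℝ) × (Fin p → ℝ))
    (i : Fin p) : |h.1 i + h.2 i| ≤ 2 * pairNorm h := by
  have h₁ : h.1 i ^ 2 ≤ ∑ j, h.1 j ^ 2 :=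
    Finset.single_le_sum (f := fun j => h.1 j ^ 2) (fun j _ => sq_nonneg _) (Finset.mem_univ i)
  have h₂ : h.2 i ^ 2 ≤ ∑ j, h.2 j ^ 2 :=
    Finset.single_le_sum (f := fun j => h.2 j ^ 2) (fun j _ => sq_nonneg _) (Finset.mem_univ i)
  have a₁ : |h.1 i| ≤ pairNorm h := Real.abs_le_sqrt (by nlinarith [sq_nonneg (h.2 i)])
  have a₂ : |h.2 i| ≤ pairNorm h := Real.abs_le_sqrt (by nlinarith [sq_nonneg (h.1 i)])
  linarith [abs_add_le (h.1 i) (h.2 i)]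

/-- Finitely many positive reals have a positive lower bound. -/
theorem exists_pos_forall_le {ι : Type*} [Finite ι] (f : ι → ℝ) (hf : ∀ i, 0 < f i) :
    ∃ m : ℝ, 0 < m ∧ ∀ i, m ≤ f i := by
  have hev : ∀ᶠ m in nhdsWithin (0 : ℝ) (Set.Ioi 0), ∀ i, m ≤ f i :=
    Filter.eventually_all.2 fun i =>
      nhdsWithin_le_nhds ((eventually_lt_nhds (hf i)).mono fun _ hm => hm.le)
  obtain ⟨m, hm, hm₀⟩ := (hev.and self_mem_nhdsWithin).exists
  exact ⟨m, hm₀, hm⟩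

/-- the KKT map F(β,d) = (β − T_λ(β+d), Gβ + nd − ỹ) is Newton
differentiable at every point, with Newton derivative
H(w)(h_β,h_d) = (h_β − D_{w₁+w₂}(h_β+h_d), G h_β + n h_d). -/
theorem stmt_7 (n p : ℕ) (hn : 0 < n) (X : Matrix (Fin n) (Fin p) ℝ) (y : Fin n → ℝ)
    (lam α : ℝ) (hlam : 0 < lam) (hα : 0 ≤ α) :
    let G := Xᵀ * X + α • (1 : Matrix (Fin p) (Fin p) ℝ)
    let ytil := Xᵀ.mulVec y
    let F : (Fin p → ℝ) × (Fin p → ℝ) → (Fin p → ℝ) × (Fin p → ℝ) := fun z =>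
      (fun i => z.1 i - softThresh lam (z.1 + z.2) i,
       fun i => G.mulVec z.1 i + (n : ℝ) * z.2 i - ytil i)
    let H : (Fin p → ℝ) × (Fin p → ℝ) → (Fin p → ℝ) × (Fin p → ℝ) →
        (Fin p → ℝ) × (Fin p → ℝ) := fun w h =>
      (fun i => h.1 i - (if lam < |w.1 i + w.2 i| then h.1 i + h.2 i else 0),
       fun i => G.mulVec h.1 i + (n : ℝ) * h.2 i)
    ∀ z : (Fin p → ℝ) × (Fin p → ℝ), ∀ ε : ℝ, 0 < ε → ∃ δ : ℝ, 0 < δ ∧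
      ∀ h : (Fin p → ℝ) × (Fin p → ℝ), 0 < pairNorm h → pairNorm h < δ →
        pairNorm (F (z + h) - F z - H (z + h) h) ≤ ε * pairNorm h := by
  intro G ytil F H z ε hε
  choose δ hδ hinc using fun i => exists_softThresh_increment_eq hlam (z.1 i + z.2 i)
  obtain ⟨m, hm, hmδ⟩ := exists_pos_forall_le δ hδ
  refine ⟨m / 2, by positivity, fun h hpos hlt => ?_⟩
  have hzero : F (z + h) - F z - H (z + h) h = 0 := by
    refine Prod.ext (funext fun i => ?_) (funext fun i => ?_)
    · have hi := hinc i (h.1 i + h.2 i)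
        (by linarith [abs_fst_add_snd_le_two_mul_pairNorm h i, hmδ i])
      have hcomm : z.1 i + h.1 i + (z.2 i + h.2 i) = z.1 i + z.2 i + (h.1 i + h.2 i) := by ring
      simp only [F, H, softThresh, Prod.fst_sub, Prod.fst_add, Prod.snd_add, Pi.sub_apply,
        Pi.add_apply, Prod.fst_zero, Pi.zero_apply, hcomm]
      linarith
    · simp only [F, H, Prod.snd_sub, Prod.fst_add, Prod.snd_add, Pi.sub_apply, Pi.add_apply,
        Prod.snd_zero, Pi.zero_apply, Matrix.mulVec_add]
      ring
  rw [hzero]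
  have hnorm : pairNorm (0 : (Fin p → ℝ) × (Fin p → ℝ)) = 0 := by simp [pairNorm]
  rw [hnorm]
  positivity
end

section
/- Let α > 0, G = XᵀX + αI, and let A ⊆ {1, …, p} be any index set with complement B. Define the linear map H_A : ℝ^p × ℝ^p → ℝ^p × ℝ^p by H_A(h_β, h_d) = (e, f), where e_i = −(h_d)_i for i ∈ A, e_i = (h_β)_i for i ∈ B, and f = G h_β + n h_d. Then H_A is invertible and its inverse satisfies the operator norm bound ‖H_A^{-1}‖ ≤ 1 + 2(n + 1 + α + ‖X‖²)²/α, where ‖X‖ is the spectral (ℓ²-operator) norm of X. -/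
open scoped BigOperators
open Matrix

attribute [local instance] Classical.propDecidable

/-- Spectral (ℓ²-operator) norm of a real matrix. -/
noncomputable def specNorm {ι κ : Type*} [Fintype ι] [Fintype κ]
    (M : Matrix ι κ ℝ) : ℝ :=
  sSup {r : ℝ | ∃ v : κ → ℝ, norm2 v ≤ 1 ∧ r = norm2 (M.mulVec v)}

section Euclidean

variable {ι κ : Type*} [Fintype ι] [Fintype κ]

theorem norm2_eq_norm_toLp (v : ι → ℝ) : norm2 v = ‖WithLp.toLp 2 v‖ := by
  simp [norm2, EuclideanSpace.norm_eq]

theorem norm2_nonneg (v : ι → ℝ) : 0 ≤ norm2 v := Real.sqrt_nonneg _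

theorem norm2_sq (v : ι → ℝ) : norm2 v ^ 2 = ∑ i, v i ^ 2 :=
  Real.sq_sqrt (Finset.sum_nonneg fun _ _ => sq_nonneg _)

theorem dotProduct_self_eq_norm2_sq (v : ι → ℝ) : v ⬝ᵥ v = norm2 v ^ 2 := by
  rw [norm2_sq]
  simp only [dotProduct, sq]

theorem norm2_add_le (v w : ι → ℝ) : norm2 (v + w) ≤ norm2 v + norm2 w := by
  simpa only [norm2_eq_norm_toLp, WithLp.toLp_add] using norm_add_le _ _

theorem norm2_smul (c : ℝ) (v : ι → ℝ) : norm2 (c • v) = |c| * norm2 v := by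
  simp only [norm2_eq_norm_toLp, WithLp.toLp_smul, norm_smul, Real.norm_eq_abs]

theorem abs_dotProduct_le (v w : ι → ℝ) : |v ⬝ᵥ w| ≤ norm2 v * norm2 w := by
  refine abs_le_of_sq_le_sq ?_ (mul_nonneg (norm2_nonneg v) (norm2_nonneg w))
  rw [mul_pow, norm2_sq, norm2_sq]
  exact Finset.sum_mul_sq_le_sq_mul_sq _ v w

theorem bddAbove_specNorm (M : Matrix ι κ ℝ) :
    BddAbove {r : ℝ | ∃ v : κ → ℝ, norm2 v ≤ 1 ∧ r = norm2 (M.mulVec v)} := by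
  classical
  let T := LinearMap.toContinuousLinearMap (Matrix.toLpLin 2 2 M)
  refine ⟨‖T‖, ?_⟩
  rintro r ⟨v, hv, rfl⟩
  rw [norm2_eq_norm_toLp] at hv ⊢
  exact (T.le_opNorm (WithLp.toLp 2 v)).trans (mul_le_of_le_one_right (norm_nonneg _) hv)

theorem norm2_mulVec_le (M : Matrix ι κ ℝ) (v : κ → ℝ) :
    norm2 (M *ᵥ v) ≤ specNorm M * norm2 v := by
  rcases (norm2_nonneg v).eq_or_lt with h | h
  · have hv : v = 0 := by
      rw [norm2_eq_norm_toLp, eq_comm, norm_eq_zero] at h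
      simpa using h
    simp [hv, norm2]
  · have hle : norm2 (M *ᵥ ((norm2 v)⁻¹ • v)) ≤ specNorm M :=
      le_csSup (bddAbove_specNorm M)
        ⟨(norm2 v)⁻¹ • v, by rw [norm2_smul, abs_of_pos (inv_pos.2 h), inv_mul_cancel₀ h.ne'], rfl⟩
    rwa [mulVec_smul, norm2_smul, abs_of_pos (inv_pos.2 h), inv_mul_le_iff₀ h, mul_comm] at hle

variable [DecidableEq κ]

theorem dotProduct_ridge_mulVec (X : Matrix ι κ ℝ) (α : ℝ) (v w : κ → ℝ) :
    v ⬝ᵥ ((Xᵀ * X + α • (1 : Matrix κ κ ℝ)) *ᵥ w) = (X *ᵥ v) ⬝ᵥ (X *ᵥ w) + α * (v ⬝ᵥ w) := by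
  rw [add_mulVec, dotProduct_add, smul_mulVec, one_mulVec, dotProduct_smul, smul_eq_mul,
    ← mulVec_mulVec, dotProduct_mulVec, vecMul_transpose]

theorem mul_norm2_sq_le_dotProduct_ridge_mulVec (X : Matrix ι κ ℝ) (α : ℝ) (v : κ → ℝ) :
    α * norm2 v ^ 2 ≤ v ⬝ᵥ ((Xᵀ * X + α • (1 : Matrix κ κ ℝ)) *ᵥ v) := by
  rw [dotProduct_ridge_mulVec, dotProduct_self_eq_norm2_sq, dotProduct_self_eq_norm2_sq]
  linarith [sq_nonneg (norm2 (X *ᵥ v))]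

theorem abs_dotProduct_ridge_mulVec_le (X : Matrix ι κ ℝ) {α : ℝ} (hα : 0 ≤ α) (v w : κ → ℝ) :
    |v ⬝ᵥ ((Xᵀ * X + α • (1 : Matrix κ κ ℝ)) *ᵥ w)| ≤
      (α + specNorm X ^ 2) * (norm2 v * norm2 w) := by
  rw [dotProduct_ridge_mulVec]
  have hX : norm2 (X *ᵥ v) * norm2 (X *ᵥ w) ≤
      (specNorm X * norm2 v) * (specNorm X * norm2 w) :=
    mul_le_mul (norm2_mulVec_le X v) (norm2_mulVec_le X w) (norm2_nonneg _)
      ((norm2_nonneg _).trans (norm2_mulVec_le X v))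
  calc |(X *ᵥ v) ⬝ᵥ (X *ᵥ w) + α * (v ⬝ᵥ w)|
      ≤ |(X *ᵥ v) ⬝ᵥ (X *ᵥ w)| + α * |v ⬝ᵥ w| := by
        simpa [abs_mul, abs_of_nonneg hα] using
          abs_add_le ((X *ᵥ v) ⬝ᵥ (X *ᵥ w)) (α * (v ⬝ᵥ w))
    _ ≤ (specNorm X * norm2 v) * (specNorm X * norm2 w) + α * (norm2 v * norm2 w) :=
        add_le_add ((abs_dotProduct_le _ _).trans hX)
          (mul_le_mul_of_nonneg_left (abs_dotProduct_le _ _) hα)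
    _ = _ := by ring

end Euclidean

theorem pairNorm_eq_sqrt {p : ℕ} (z : (Fin p → ℝ) × (Fin p → ℝ)) :
    pairNorm z = √(norm2 z.1 ^ 2 + norm2 z.2 ^ 2) := by
  rw [norm2_sq, norm2_sq, pairNorm]

theorem norm2_fst_le_pairNorm {p : ℕ} (z : (Fin p → ℝ) × (Fin p → ℝ)) :
    norm2 z.1 ≤ pairNorm z := by
  rw [pairNorm_eq_sqrt]
  exact Real.le_sqrt_of_sq_le (by linarith [sq_nonneg (norm2 z.2)])

theorem norm2_snd_le_pairNorm {p : ℕ} (z : (Fin p → ℝ) × (Fin p → ℝ)) :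
    norm2 z.2 ≤ pairNorm z := by
  rw [pairNorm_eq_sqrt]
  exact Real.le_sqrt_of_sq_le (by linarith [sq_nonneg (norm2 z.1)])

theorem eq_zero_of_pairNorm_nonpos {p : ℕ} {z : (Fin p → ℝ) × (Fin p → ℝ)}
    (h : pairNorm z ≤ 0) : z = 0 := by
  have h₁ := (norm2_fst_le_pairNorm z).trans h
  have h₂ := (norm2_snd_le_pairNorm z).trans h
  rw [norm2_eq_norm_toLp, norm_le_zero_iff] at h₁ h₂
  exact Prod.ext (by simpa using h₁) (by simpa using h₂)

/-- The generalized Jacobian `H_A` attached to a matrix `G`, a scalar `c` and an index set `A`. -/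
noncomputable def activeSetMap {p : ℕ} (G : Matrix (Fin p) (Fin p) ℝ) (c : ℝ) (A : Set (Fin p)) :
    (Fin p → ℝ) × (Fin p → ℝ) →ₗ[ℝ] (Fin p → ℝ) × (Fin p → ℝ) where
  toFun h := (fun i => if i ∈ A then -(h.2 i) else h.1 i, fun i => G.mulVec h.1 i + c * h.2 i)
  map_add' x y := by
    ext i
    · by_cases hi : i ∈ A <;> simp [hi, add_comm]
    · simp [mulVec_add]; ring
  map_smul' r x := by
    ext i
    · by_cases hi : i ∈ A <;> simp [hi]
    · simp [mulVec_smul]; ring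

theorem pairNorm_le_activeSetMap {n p : ℕ} (X : Matrix (Fin n) (Fin p) ℝ) {α c : ℝ} (hα : 0 < α)
    (hc : 1 ≤ c) (A : Set (Fin p)) (z : (Fin p → ℝ) × (Fin p → ℝ)) :
    pairNorm z ≤ (1 + 2 * (c + 1 + α + specNorm X ^ 2) ^ 2 / α) *
      pairNorm (activeSetMap (Xᵀ * X + α • (1 : Matrix (Fin p) (Fin p) ℝ)) c A z) := by
  obtain ⟨u, v⟩ := z
  set G := Xᵀ * X + α • (1 : Matrix (Fin p) (Fin p) ℝ)
  set L := α + specNorm X ^ 2 with hL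
  set w := pairNorm (activeSetMap G c A (u, v))
  set e : Fin p → ℝ := fun i => if i ∈ A then -(v i) else u i with he
  set f : Fin p → ℝ := G *ᵥ u + c • v with hf
  have he_le : norm2 e ≤ w := norm2_fst_le_pairNorm (activeSetMap G c A (u, v))
  have hf_le : norm2 f ≤ w := norm2_snd_le_pairNorm (activeSetMap G c A (u, v))
  set a : Fin p → ℝ := fun i => if i ∈ A then u i else 0 with ha
  set b : Fin p → ℝ := fun i => if i ∈ A then 0 else u i with hb
  set d : Fin p → ℝ := fun i => if i ∈ A then 0 else v i with hd
  have hw0 : 0 ≤ w := Real.sqrt_nonneg _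
  have ha0 := norm2_nonneg a
  have hd0 := norm2_nonneg d
  have he0 := norm2_nonneg e
  have hLα : α ≤ L := by rw [hL]; linarith [sq_nonneg (specNorm X)]
  have huab : u = a + b := by
    ext i; by_cases hi : i ∈ A <;> simp [ha, hb, hi]
  have hb_le : norm2 b ≤ norm2 e := by
    refine Real.sqrt_le_sqrt (Finset.sum_le_sum fun i _ => ?_)
    by_cases hi : i ∈ A <;> simp [hb, he, hi, sq_nonneg]
  have hav : a ⬝ᵥ v = -(a ⬝ᵥ e) := by
    rw [← dotProduct_neg]
    refine Finset.sum_congr rfl fun i _ => ?_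
    by_cases hi : i ∈ A <;> simp [ha, he, hi]
  have hdv : d ⬝ᵥ v = norm2 d ^ 2 := by
    rw [← dotProduct_self_eq_norm2_sq]
    refine Finset.sum_congr rfl fun i _ => ?_
    by_cases hi : i ∈ A <;> simp [hd, hi]
  have hnorm : pairNorm (u, v) ≤ norm2 e + norm2 a + norm2 d := by
    refine Real.sqrt_le_iff.2 ⟨by positivity, ?_⟩
    have hsum : ∑ i, u i ^ 2 + ∑ i, v i ^ 2 = norm2 e ^ 2 + norm2 a ^ 2 + norm2 d ^ 2 := by
      simp only [norm2_sq, ← Finset.sum_add_distrib]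
      refine Finset.sum_congr rfl fun i _ => ?_
      by_cases hi : i ∈ A <;> simp [he, ha, hd, hi, add_comm]
    rw [hsum]
    nlinarith [mul_nonneg he0 ha0, mul_nonneg he0 hd0, mul_nonneg ha0 hd0]
  have ha_le : α * norm2 a ≤ (c + 1 + L) * w := by
    rcases ha0.eq_or_lt with h0 | hpos
    · rw [← h0, mul_zero]; positivity
    have hdot : a ⬝ᵥ f = a ⬝ᵥ (G *ᵥ a) + a ⬝ᵥ (G *ᵥ b) - c * (a ⬝ᵥ e) := by
      have hGu : G *ᵥ u = G *ᵥ a + G *ᵥ b := by rw [← mulVec_add, ← huab]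
      rw [hf, dotProduct_add, dotProduct_smul, hav, smul_eq_mul, hGu, dotProduct_add]
      ring
    have hcoer : α * norm2 a ^ 2 ≤ a ⬝ᵥ (G *ᵥ a) := mul_norm2_sq_le_dotProduct_ridge_mulVec X α a
    have hGb : |a ⬝ᵥ (G *ᵥ b)| ≤ L * (norm2 a * norm2 b) :=
      abs_dotProduct_ridge_mulVec_le X hα.le a b
    have haf := (le_abs_self _).trans (abs_dotProduct_le a f)
    have hae := mul_le_mul_of_nonneg_left ((le_abs_self _).trans (abs_dotProduct_le a e))
      (zero_le_one.trans hc)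
    have hsq : norm2 a * (α * norm2 a) ≤ norm2 a * (norm2 f + L * norm2 b + c * norm2 e) := by
      linarith [neg_le_of_abs_le hGb]
    have hdiv := le_of_mul_le_mul_left hsq hpos
    have h₁ : L * norm2 b ≤ L * w := by gcongr; exact hb_le.trans he_le
    have h₂ : c * norm2 e ≤ c * w := by gcongr
    linarith
  have hd_le : norm2 d ≤ w + L * (norm2 a + w) := by
    rcases hd0.eq_or_lt with h0 | hpos
    · rw [← h0]; positivity
    have hdot : d ⬝ᵥ f = d ⬝ᵥ (G *ᵥ u) + c * norm2 d ^ 2 := by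
      rw [hf, dotProduct_add, dotProduct_smul, hdv, smul_eq_mul]
    have hGu : |d ⬝ᵥ (G *ᵥ u)| ≤ L * (norm2 d * norm2 u) :=
      abs_dotProduct_ridge_mulVec_le X hα.le d u
    have hdf := (le_abs_self _).trans (abs_dotProduct_le d f)
    have hcd : norm2 d ^ 2 ≤ c * norm2 d ^ 2 := le_mul_of_one_le_left (sq_nonneg _) hc
    have hsq : norm2 d * norm2 d ≤ norm2 d * (norm2 f + L * norm2 u) := by
      linarith [neg_le_of_abs_le hGu]
    have hdiv := le_of_mul_le_mul_left hsq hpos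
    have hu_le : norm2 u ≤ norm2 a + w := by
      rw [huab]; linarith [norm2_add_le a b]
    have h₁ : L * norm2 u ≤ L * (norm2 a + w) := by gcongr
    linarith
  have hK : c + 1 + α + specNorm X ^ 2 = c + 1 + L := by rw [hL]; ring
  rw [hK]
  have hL0 : 0 < L := hα.trans_le hLα
  have hKpos : 0 < c + 1 + L := by linarith
  have ha_le' : norm2 a ≤ (c + 1 + L) / α * w := by
    rw [div_mul_eq_mul_div, le_div_iff₀ hα]; linarith
  have hratio : 1 ≤ (c + 1 + L) / α := by rw [le_div_iff₀ hα]; linarith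
  calc pairNorm (u, v) ≤ w + (1 + L) * w + (1 + L) * norm2 a := by linarith
    _ ≤ w + (1 + L) * ((c + 1 + L) / α * w) + (1 + L) * ((c + 1 + L) / α * w) := by
        gcongr
        exact le_mul_of_one_le_left hw0 hratio
    _ = w + 2 * ((1 + L) * ((c + 1 + L) / α * w)) := by ring
    _ ≤ w + 2 * ((c + 1 + L) * ((c + 1 + L) / α * w)) := by
        gcongr
        linarith
    _ = _ := by ring

/-- with α > 0, G = XᵀX + αI and any index set A (B its complement),
the linear map H_A(h_β,h_d) = (e, G h_β + n h_d), where e_i = −(h_d)_i on A and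
e_i = (h_β)_i on B, is invertible with ‖H_A⁻¹‖ ≤ 1 + 2(n+1+α+‖X‖²)²/α. -/
theorem stmt_8 (n p : ℕ) (hn : 0 < n) (X : Matrix (Fin n) (Fin p) ℝ)
    (α : ℝ) (hα : 0 < α) (A : Set (Fin p)) :
    let G := Xᵀ * X + α • (1 : Matrix (Fin p) (Fin p) ℝ)
    let H : (Fin p → ℝ) × (Fin p → ℝ) → (Fin p → ℝ) × (Fin p → ℝ) := fun h =>
      (fun i => if i ∈ A then -(h.2 i) else h.1 i,
       fun i => G.mulVec h.1 i + (n : ℝ) * h.2 i)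
    Function.Bijective H ∧
      ∀ z : (Fin p → ℝ) × (Fin p → ℝ),
        pairNorm z ≤ (1 + 2 * ((n : ℝ) + 1 + α + specNorm X ^ 2) ^ 2 / α) * pairNorm (H z) := by
  intro G H
  have hbound := pairNorm_le_activeSetMap X hα (Nat.one_le_cast.2 hn : (1 : ℝ) ≤ n) A
  have hinj : Function.Injective (activeSetMap G n A) := by
    refine (injective_iff_map_eq_zero _).2 fun z hz => eq_zero_of_pairNorm_nonpos ?_
    have := hbound z
    rw [hz] at this
    simpa [pairNorm] using this
  exact ⟨⟨hinj, LinearMap.injective_iff_surjective.1 hinj⟩, hbound⟩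
end

section
/- Let λ > 0, α > 0, G = XᵀX + αI, ỹ = Xᵀy, and F(β, d) = (β − T_λ(β + d), Gβ + n d − ỹ). Let z_α = (β̂, d̂) be the root of F (i.e., the KKT pair of the Enet problem). For z = (β, d) let H(z) be the linear map (h_β, h_d) ↦ (h_β − D_{β+d}(h_β + h_d), G h_β + n h_d), where (D_w h)_i = h_i if |w_i| > λ and 0 otherwise. Then the semismooth Newton iteration converges locally superlinearly to z_α: for every c > 0 there exists δ > 0 such that for every z with 0 < ‖z − z_α‖₂ ≤ δ, the map H(z) is invertible and the Newton update z⁺ = z − H(z)^{-1} F(z) satisfies ‖z⁺ − z_α‖₂ ≤ c ‖z − z_α‖₂. -/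
open scoped BigOperators
open Matrix

/-- The scalar soft-threshold map is piecewise affine, so near any point its increments are given
exactly by its generalized derivative at the perturbed point. -/
theorem eventually_softThresh_sub_eq {lam : ℝ} (hlam : 0 < lam) (a : ℝ) :
    ∀ᶠ w in nhds a, (w - |w + lam| / 2 + |w - lam| / 2) - (a - |a + lam| / 2 + |a - lam| / 2)
      = if lam < |w| then w - a else 0 := by
  have key : ∃ ε > 0, ∀ w : ℝ, |w - a| < ε →
      (w - |w + lam| / 2 + |w - lam| / 2) - (a - |a + lam| / 2 + |a - lam| / 2)
        = if lam < |w| then w - a else 0 := by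
    rcases lt_trichotomy |a| lam with ha | ha | ha
    · refine ⟨lam - |a|, by linarith, fun w hw => ?_⟩
      grind
    · refine ⟨lam, hlam, fun w hw => ?_⟩
      grind
    · refine ⟨|a| - lam, by linarith, fun w hw => ?_⟩
      grind
  obtain ⟨ε, hε, h⟩ := key
  exact Metric.eventually_nhds_iff.2 ⟨ε, hε, fun w hw => h w (by rwa [← Real.dist_eq])⟩

theorem abs_fst_le_pairNorm {p : ℕ} (z : (Fin p → ℝ) × (Fin p → ℝ)) (i : Fin p) :
    |z.1 i| ≤ pairNorm z := by
  refine Real.abs_le_sqrt ?_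
  have h₁ := Finset.single_le_sum (f := fun j => z.1 j ^ 2) (fun j _ => sq_nonneg _)
    (Finset.mem_univ i)
  have h₂ : 0 ≤ ∑ j, z.2 j ^ 2 := Finset.sum_nonneg fun j _ => sq_nonneg _
  linarith

theorem abs_snd_le_pairNorm {p : ℕ} (z : (Fin p → ℝ) × (Fin p → ℝ)) (i : Fin p) :
    |z.2 i| ≤ pairNorm z := by
  refine Real.abs_le_sqrt ?_
  have h₁ := Finset.single_le_sum (f := fun j => z.2 j ^ 2) (fun j _ => sq_nonneg _)
    (Finset.mem_univ i)
  have h₂ : 0 ≤ ∑ j, z.1 j ^ 2 := Finset.sum_nonneg fun j _ => sq_nonneg _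
  linarith

/-- The linear map `h ↦ (h.1 - D_s (h.1 + h.2), G h.1 + c h.2)`, where `D_s` is the coordinate
projection onto the active set `s`. -/
noncomputable def newtonMap {p : ℕ} (G : Matrix (Fin p) (Fin p) ℝ) (c : ℝ) (s : Fin p → Prop)
    [DecidablePred s] :
    ((Fin p → ℝ) × (Fin p → ℝ)) →ₗ[ℝ] (Fin p → ℝ) × (Fin p → ℝ) where
  toFun h := (fun i => h.1 i - (if s i then h.1 i + h.2 i else 0),
    fun i => G.mulVec h.1 i + c * h.2 i)
  map_add' h k := by
    ext i
    · simp only [Prod.fst_add, Prod.snd_add, Pi.add_apply]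
      split_ifs <;> ring
    · simp only [Prod.fst_add, Prod.snd_add, Pi.add_apply, mulVec_add]
      ring
  map_smul' r h := by
    ext i
    · simp only [Prod.smul_fst, Prod.smul_snd, Pi.smul_apply, smul_eq_mul, RingHom.id_apply]
      split_ifs <;> ring
    · simp only [Prod.smul_fst, Prod.smul_snd, Pi.smul_apply, smul_eq_mul, RingHom.id_apply,
        mulVec_smul]
      ring

theorem newtonMap_bijective {p : ℕ} {G : Matrix (Fin p) (Fin p) ℝ}
    (hG : ∀ v : Fin p → ℝ, v ⬝ᵥ G *ᵥ v = 0 → v = 0) {c : ℝ} (hc : c ≠ 0) (s : Fin p → Prop)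
    [DecidablePred s] : Function.Bijective (newtonMap G c s) := by
  have hinj : Function.Injective (newtonMap G c s) := by
    rw [injective_iff_map_eq_zero]
    intro h hh
    have e₁ : ∀ i, h.1 i - (if s i then h.1 i + h.2 i else 0) = 0 :=
      fun i => congrFun (congrArg Prod.fst hh) i
    have e₂ : ∀ i, G.mulVec h.1 i + c * h.2 i = 0 := fun i => congrFun (congrArg Prod.snd hh) i
    have h₁ : h.1 = 0 := by
      refine hG _ (Finset.sum_eq_zero fun i _ => ?_)
      have h₁ := e₁ i
      have h₂ := e₂ i
      split_ifs at h₁ with hs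
      · have h₃ : h.2 i = 0 := by linarith
        rw [h₃, mul_zero, add_zero] at h₂
        rw [h₂, mul_zero]
      · rw [sub_zero] at h₁
        rw [h₁, zero_mul]
    have h₂ : h.2 = 0 := by
      funext i
      have h₂ := e₂ i
      rw [h₁, mulVec_zero, Pi.zero_apply, zero_add] at h₂
      exact (mul_eq_zero.1 h₂).resolve_left hc
    exact Prod.ext h₁ h₂
  exact ⟨hinj, LinearMap.injective_iff_surjective.1 hinj⟩

theorem eq_zero_of_dotProduct_ridge_mulVec_eq_zero {m p : ℕ} (X : Matrix (Fin m) (Fin p) ℝ)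
    {α : ℝ} (hα : 0 < α) (v : Fin p → ℝ)
    (hv : v ⬝ᵥ (Xᵀ * X + α • (1 : Matrix (Fin p) (Fin p) ℝ)) *ᵥ v = 0) : v = 0 := by
  rw [add_mulVec, dotProduct_add, ← mulVec_mulVec, dotProduct_mulVec, vecMul_transpose,
    smul_mulVec, one_mulVec, dotProduct_smul, smul_eq_mul] at hv
  have h₁ : 0 ≤ (X *ᵥ v) ⬝ᵥ (X *ᵥ v) := Finset.sum_nonneg fun i _ => mul_self_nonneg _
  have h₂ : 0 ≤ v ⬝ᵥ v := Finset.sum_nonneg fun i _ => mul_self_nonneg _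
  exact dotProduct_self_eq_zero.1 (by nlinarith)

/-- local superlinear convergence of the semismooth Newton iteration
for the Enet KKT map F at its root z_α: for every c > 0 there is δ > 0 such that
whenever 0 < ‖z − z_α‖₂ ≤ δ, H(z) is invertible and the Newton update
z⁺ = z − H(z)⁻¹F(z) satisfies ‖z⁺ − z_α‖₂ ≤ c‖z − z_α‖₂. -/
theorem stmt_9 (n p : ℕ) (hn : 0 < n) (X : Matrix (Fin n) (Fin p) ℝ) (y : Fin n → ℝ)
    (lam α : ℝ) (hlam : 0 < lam) (hα : 0 < α)
    (G : Matrix (Fin p) (Fin p) ℝ) (hG : G = Xᵀ * X + α • (1 : Matrix (Fin p) (Fin p) ℝ))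
    (F : (Fin p → ℝ) × (Fin p → ℝ) → (Fin p → ℝ) × (Fin p → ℝ))
    (hF : F = fun z =>
      (fun i => z.1 i - softThresh lam (z.1 + z.2) i,
       fun i => G.mulVec z.1 i + (n : ℝ) * z.2 i - Xᵀ.mulVec y i))
    (H : (Fin p → ℝ) × (Fin p → ℝ) → (Fin p → ℝ) × (Fin p → ℝ) →
      (Fin p → ℝ) × (Fin p → ℝ))
    (hH : H = fun w h =>
      (fun i => h.1 i - (if lam < |w.1 i + w.2 i| then h.1 i + h.2 i else 0),
       fun i => G.mulVec h.1 i + (n : ℝ) * h.2 i))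
    (zα : (Fin p → ℝ) × (Fin p → ℝ)) (hroot : F zα = 0) :
    ∀ c : ℝ, 0 < c → ∃ δ : ℝ, 0 < δ ∧
      ∀ z : (Fin p → ℝ) × (Fin p → ℝ), 0 < pairNorm (z - zα) → pairNorm (z - zα) ≤ δ →
        Function.Bijective (H z) ∧
          ∀ w, H z w = F z → pairNorm (z - w - zα) ≤ c * pairNorm (z - zα) := by
  intro c hc
  have hlin : ∀ᶠ w in nhds (zα.1 + zα.2), ∀ i, softThresh lam w i - softThresh lam (zα.1 + zα.2) i
      = if lam < |w i| then w i - (zα.1 + zα.2) i else 0 :=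
    Filter.eventually_all.2 fun i =>
      ((continuous_apply i).tendsto (zα.1 + zα.2)).eventually
        (eventually_softThresh_sub_eq hlam ((zα.1 + zα.2) i))
  obtain ⟨ε, hε, hball⟩ := Metric.eventually_nhds_iff.1 hlin
  refine ⟨ε / 3, by positivity, fun z _ hz => ?_⟩
  have hHz : H z = newtonMap G n fun i => lam < |z.1 i + z.2 i| := by
    rw [hH]
    rfl
  have hbij : Function.Bijective (H z) := by
    rw [hHz]
    refine newtonMap_bijective ?_ (by positivity) _
    rw [hG]
    exact eq_zero_of_dotProduct_ridge_mulVec_eq_zero X hα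
  refine ⟨hbij, fun w hw => ?_⟩
  have hdist : dist (z.1 + z.2) (zα.1 + zα.2) < ε := by
    rw [dist_pi_lt_iff hε]
    intro i
    have h₁ := abs_fst_le_pairNorm (z - zα) i
    have h₂ := abs_snd_le_pairNorm (z - zα) i
    have h₃ := abs_add_le ((z - zα).1 i) ((z - zα).2 i)
    have h₄ : (z.1 + z.2) i - (zα.1 + zα.2) i = (z - zα).1 i + (z - zα).2 i := by
      simp only [Prod.fst_sub, Prod.snd_sub, Pi.add_apply, Pi.sub_apply]
      ring
    rw [Real.dist_eq, h₄]
    linarith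
  have hFz : H z (z - zα) = F z := by
    rw [hF] at hroot ⊢
    rw [hH]
    ext i
    · have h₁ := congrFun (congrArg Prod.fst hroot) i
      have h₂ := hball hdist i
      simp only [Prod.fst_sub, Prod.snd_sub, Pi.sub_apply, Pi.add_apply, Prod.fst_zero,
        Pi.zero_apply] at h₁ h₂ ⊢
      split_ifs at h₂ ⊢ <;> linarith
    · have h₁ := congrFun (congrArg Prod.snd hroot) i
      simp only [Prod.fst_sub, Prod.snd_sub, Pi.sub_apply, Prod.snd_zero, Pi.zero_apply,
        mulVec_sub] at h₁ ⊢
      linarith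
  have hwz : w = z - zα := hbij.injective (hw.trans hFz.symm)
  have hzero : pairNorm (z - w - zα) = 0 := by
    simp [hwz, pairNorm]
  rw [hzero]
  exact mul_nonneg hc.le (Real.sqrt_nonneg _)
end

section
/- Let y = Xβ† + η with X ∈ ℝ^{n×p} (p ≥ 2) √n-normalized and with mutual coherence ν; let A† = supp(β†), T = |A†| ≥ 1, and assume Tν ≤ 1/4 and ‖Xᵀη‖_∞ ≤ n λ_u for some λ_u > 0. Set δ_u = 3λ_u, let λ > 10 δ_u, λ̄ = (9/10)λ + δ_u, and κ = 8/5. For τ > 0 define S_{λ,τ} = {i : |β†_i| ≥ λτ}. Let A ⊆ A† with A ≠ A†, let s ∈ {−1,+1}^{|A|} be any sign vector, let (β⁺, d⁺) be the SNA one-step update from A with shift λ̄ and signs s, and let A⁺ = {i : |β⁺_i + d⁺_i| > λ}. Then: (a) if τ ∈ {κ, κ+1} and S_{λ,τ} ⊆ A, then S_{λ,τ} ⊆ A⁺ ⊆ A†; (b) if S_{λ,κ+1} ⊆ A, S_{λ,κ} ⊄ A, and A⁺ ≠ A†, then max_{i ∈ A†\A⁺} |β†_i| < max_{i ∈ A†\A}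 |β†_i|. -/
open scoped BigOperators
open Matrix

attribute [local instance] Classical.propDecidable

/-- Mutual coherence ν = max_{i≠j} |X_iᵀ X_j| / n of a design matrix. -/
noncomputable def coherence (n p : ℕ) (X : Matrix (Fin n) (Fin p) ℝ) : ℝ :=
  sSup {r : ℝ | ∃ i j : Fin p, i ≠ j ∧ r = |∑ k, X k i * X k j| / n}

/-- The Gram entry of two distinct columns is at most `n` times the coherence. -/
theorem abs_gram_le_mul_coherence {n p : ℕ} (hn : 0 < n) (X : Matrix (Fin n) (Fin p) ℝ)
    {i j : Fin p} (hij : i ≠ j) : |∑ k, X k i * X k j| ≤ n * coherence n p X := by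
  have hfin : {r : ℝ | ∃ i j : Fin p, i ≠ j ∧ r = |∑ k, X k i * X k j| / n}.Finite := by
    refine (Set.finite_range
      (fun q : Fin p × Fin p => |∑ k, X k q.1 * X k q.2| / (n : ℝ))).subset ?_
    rintro r ⟨i, j, -, rfl⟩
    exact ⟨(i, j), rfl⟩
  have h : |∑ k, X k i * X k j| / n ≤ coherence n p X :=
    le_csSup hfin.bddAbove ⟨i, j, hij, rfl⟩
  have hn' : (0 : ℝ) < n := by exact_mod_cast hn
  rw [div_le_iff₀ hn'] at h
  linarith

theorem coherence_nonneg (n p : ℕ) (X : Matrix (Fin n) (Fin p) ℝ) : 0 ≤ coherence n p X := by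
  refine Real.sSup_nonneg ?_
  rintro r ⟨i, j, -, rfl⟩
  positivity

/-- The off-diagonal part of the Gram matrix acts on sparse vectors with small sup norm. -/
theorem abs_gram_mulVec_sub_le {n p : ℕ} (hn : 0 < n) (X : Matrix (Fin n) (Fin p) ℝ)
    (hX : ∀ j, ∑ k, X k j ^ 2 = (n : ℝ)) (S : Finset (Fin p)) (r : Fin p → ℝ)
    (hr : ∀ i, i ∉ S → r i = 0) {R : ℝ} (hR : ∀ i, |r i| ≤ R) (j : Fin p) :
    |∑ k, X k j * X.mulVec r k - n * r j| ≤ n * (S.card * coherence n p X) * R := by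
  have hR0 : 0 ≤ R := (abs_nonneg _).trans (hR j)
  have hν := coherence_nonneg n p X
  have hexp : ∑ k, X k j * X.mulVec r k = ∑ i, (∑ k, X k j * X k i) * r i := by
    simp only [mulVec, dotProduct, Finset.mul_sum, Finset.sum_mul]
    rw [Finset.sum_comm]
    simp only [mul_assoc]
  have hdiag : (n : ℝ) * r j = (∑ k, X k j * X k j) * r j := by
    rw [← hX j]
    simp only [sq]
  rw [hexp, hdiag, ← Finset.add_sum_erase _ _ (Finset.mem_univ j), add_sub_cancel_left]
  calc |∑ i ∈ Finset.univ.erase j, (∑ k, X k j * X k i) * r i|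
      ≤ ∑ i ∈ Finset.univ.erase j, |(∑ k, X k j * X k i) * r i| :=
        Finset.abs_sum_le_sum_abs _ _
    _ ≤ ∑ i ∈ Finset.univ.erase j, if i ∈ S then n * coherence n p X * R else 0 := by
        refine Finset.sum_le_sum fun i hi => ?_
        split_ifs with his
        · rw [abs_mul]
          exact mul_le_mul (abs_gram_le_mul_coherence hn X (Finset.ne_of_mem_erase hi).symm)
            (hR i) (abs_nonneg _) (by positivity)
        · simp [hr i his]
    _ ≤ ∑ i, if i ∈ S then n * coherence n p X * R else 0 :=
        Finset.sum_le_sum_of_subset_of_nonneg (Finset.erase_subset _ _) fun i _ _ => by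
          split_ifs <;> positivity
    _ = n * (S.card * coherence n p X) * R := by
        simp only [Finset.sum_ite_mem, Finset.univ_inter, Finset.sum_const, nsmul_eq_mul]
        ring

/-- Gram matrices of few columns of an incoherent design are invertible. -/
theorem isUnit_det_gram_submatrix {n p : ℕ} (hn : 0 < n) (X : Matrix (Fin n) (Fin p) ℝ)
    (hX : ∀ j, ∑ k, X k j ^ 2 = (n : ℝ)) (A : Finset (Fin p))
    (hA : (A.card : ℝ) * coherence n p X < 1) :
    IsUnit ((X.submatrix id (fun j : ↥A => (j : Fin p)))ᵀ *
      (X.submatrix id (fun j : ↥A => (j : Fin p)))).det := by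
  have hn' : (0 : ℝ) < n := by exact_mod_cast hn
  have hν := coherence_nonneg n p X
  refine isUnit_iff_ne_zero.2 (det_ne_zero_of_sum_row_lt_diag fun j => ?_)
  simp only [mul_apply, transpose_apply, submatrix_apply, id_eq, Real.norm_eq_abs]
  have hd : ∑ k, X k (j : Fin p) * X k j = n := by
    rw [← hX j]
    simp only [sq]
  rw [hd, abs_of_pos hn']
  calc ∑ i ∈ Finset.univ.erase j, |∑ k, X k (j : Fin p) * X k (i : Fin p)|
      ≤ ∑ _i ∈ Finset.univ.erase j, n * coherence n p X := by
        refine Finset.sum_le_sum fun i hi => abs_gram_le_mul_coherence hn X fun h => ?_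
        exact Finset.ne_of_mem_erase hi (Subtype.ext h.symm)
    _ ≤ ∑ _i : ↥A, n * coherence n p X :=
        Finset.sum_le_sum_of_subset_of_nonneg (Finset.erase_subset _ _) fun i _ _ => by positivity
    _ = n * (A.card * coherence n p X) := by
        simp only [Finset.sum_const, Finset.card_univ, Fintype.card_coe, nsmul_eq_mul]
        ring
    _ < n := by nlinarith

/-- The least-squares update on `A` satisfies the normal equations. -/
theorem normal_equations_of_eq_inv_mulVec {n p : ℕ} (X : Matrix (Fin n) (Fin p) ℝ)
    (A : Finset (Fin p))
    (hdet : IsUnit ((X.submatrix id (fun j : ↥A => (j : Fin p)))ᵀ *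
      (X.submatrix id (fun j : ↥A => (j : Fin p)))).det)
    (b : ↥A → ℝ) (β : Fin p → ℝ)
    (hβ : β = fun j => if h : j ∈ A then
      (((X.submatrix id (fun j' : ↥A => (j' : Fin p)))ᵀ *
        (X.submatrix id (fun j' : ↥A => (j' : Fin p))))⁻¹.mulVec b) ⟨j, h⟩ else 0)
    (j : ↥A) : ∑ k, X k j * X.mulVec β k = b j := by
  set Y := X.submatrix id (fun j : ↥A => (j : Fin p)) with hY
  have hout : ∀ i, i ∉ A → β i = 0 := fun i hi => by simp [hβ, hi]
  have hin : (fun i : ↥A => β i) = (Yᵀ * Y)⁻¹.mulVec b := by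
    funext i
    simp [hβ]
  have hXβ : X.mulVec β = Y.mulVec (fun i : ↥A => β i) := by
    funext k
    simp only [mulVec, dotProduct, hY, submatrix_apply, id_eq]
    rw [Finset.sum_coe_sort A (fun i => X k i * β i)]
    refine (Finset.sum_subset (Finset.subset_univ A) fun i _ hi => ?_).symm
    simp [hout i hi]
  have h : Yᵀ.mulVec (X.mulVec β) = b := by
    rw [hXβ, hin, mulVec_mulVec, mulVec_mulVec, mul_nonsing_inv _ hdet, one_mulVec]
  exact congrFun h j

/-- active-set monotonicity of the SNA update. With κ = 8/5 and
S_{λ,τ} = {i : |β†_i| ≥ λτ}: (a) if τ ∈ {κ, κ+1} and S_{λ,τ} ⊆ A then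
S_{λ,τ} ⊆ A⁺ ⊆ A†; (b) if S_{λ,κ+1} ⊆ A, S_{λ,κ} ⊄ A and A⁺ ≠ A†, then
max_{A†\A⁺}|β†| < max_{A†\A}|β†| (the latter max being |β†_{i*}|). -/
theorem stmt_18 (n p : ℕ) (hn : 0 < n) (hp : 2 ≤ p)
    (X : Matrix (Fin n) (Fin p) ℝ) (hX : ∀ j, ∑ k, X k j ^ 2 = (n : ℝ))
    (βdag : Fin p → ℝ) (η : Fin n → ℝ)
    (lamu : ℝ) (hlamu : 0 < lamu)
    (hnoise : ∀ j, |∑ i, X i j * η i| ≤ (n : ℝ) * lamu)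
    (hT : 1 ≤ (Finset.filter (fun j => βdag j ≠ 0) Finset.univ).card)
    (hA1 : ((Finset.filter (fun j => βdag j ≠ 0) Finset.univ).card : ℝ) *
      coherence n p X ≤ 1 / 4)
    (lam : ℝ) (hlam : 10 * (3 * lamu) < lam)
    (lambar : ℝ) (hlambar : lambar = (9 / 10) * lam + 3 * lamu)
    (y : Fin n → ℝ) (hy : y = X.mulVec βdag + η)
    (A : Finset (Fin p)) (hA : ∀ i ∈ A, βdag i ≠ 0)
    (istar : Fin p) (histar1 : βdag istar ≠ 0) (histar2 : istar ∉ A)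
    (histar3 : ∀ i, βdag i ≠ 0 → i ∉ A → |βdag i| ≤ |βdag istar|)
    (s : Fin p → ℝ) (hs : ∀ i ∈ A, s i = 1 ∨ s i = -1)
    (βplus : Fin p → ℝ)
    (hβplus : βplus = fun j =>
      if h : j ∈ A then
        (((X.submatrix id (fun j' : ↥A => (j' : Fin p)))ᵀ *
            (X.submatrix id (fun j' : ↥A => (j' : Fin p))))⁻¹.mulVec
          (fun j' : ↥A => (∑ i, X i (j' : Fin p) * y i)
            - (n : ℝ) * ((lam - lambar) * s (j' : Fin p)))) ⟨j, h⟩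
      else 0)
    (dplus : Fin p → ℝ)
    (hdplus : dplus = fun j =>
      if j ∈ A then (lam - lambar) * s j
      else (∑ i, X i j * (y i - X.mulVec βplus i)) / n) :
    (∀ τ : ℝ, (τ = 8 / 5 ∨ τ = 8 / 5 + 1) →
      {i : Fin p | lam * τ ≤ |βdag i|} ⊆ (A : Set (Fin p)) →
      ({i : Fin p | lam * τ ≤ |βdag i|} ⊆ {i : Fin p | lam < |βplus i + dplus i|} ∧
        {i : Fin p | lam < |βplus i + dplus i|} ⊆ {i : Fin p | βdag i ≠ 0})) ∧
    ({i : Fin p | lam * (8 / 5 + 1) ≤ |βdag i|} ⊆ (A : Set (Fin p)) →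
      ¬ ({i : Fin p | lam * (8 / 5) ≤ |βdag i|} ⊆ (A : Set (Fin p))) →
      {i : Fin p | lam < |βplus i + dplus i|} ≠ {i : Fin p | βdag i ≠ 0} →
      ∀ i, βdag i ≠ 0 → ¬ (lam < |βplus i + dplus i|) → |βdag i| < |βdag istar|) := by
  have hn' : (0 : ℝ) < n := by exact_mod_cast hn
  have hν := coherence_nonneg n p X
  set S := Finset.filter (fun j => βdag j ≠ 0) Finset.univ with hS
  have hAS : A ⊆ S := fun i hi => by simp [hS, hA i hi]
  have hAcard : (A.card : ℝ) * coherence n p X < 1 := by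
    have : (A.card : ℝ) ≤ S.card := by exact_mod_cast Finset.card_le_card hAS
    nlinarith
  have hout : ∀ i, i ∉ A → βplus i = 0 := fun i hi => by simp [hβplus, hi]
  have hdA : ∀ i ∈ A, dplus i = (lam - lambar) * s i := fun i hi => by simp [hdplus, hi]
  have hresid : ∀ j, ∑ k, X k j * (y k - X.mulVec βplus k) = n * dplus j := by
    intro j
    by_cases hj : j ∈ A
    · have h := normal_equations_of_eq_inv_mulVec X A
        (isUnit_det_gram_submatrix hn X hX A hAcard) _ βplus hβplus ⟨j, hj⟩
      simp only at h
      simp only [mul_sub, Finset.sum_sub_distrib, h, hdA j hj]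
      ring
    · simp only [hdplus, hj, if_false]
      field_simp
  set r : Fin p → ℝ := βplus - βdag with hr
  have hrS : ∀ i, i ∉ S → r i = 0 := by
    intro i hi
    have h1 : βdag i = 0 := by simpa [hS] using hi
    simp [hr, h1, hout i (fun h => hi (hAS h))]
  have herr : ∀ R, (∀ i, |r i| ≤ R) → ∀ j, |βplus j + dplus j - βdag j| ≤ lamu + R / 4 := by
    intro R hR j
    have hR0 : 0 ≤ R := (abs_nonneg _).trans (hR j)
    have h1 := abs_gram_mulVec_sub_le hn X hX S r hrS hR j
    have h2 : n * ((S.card : ℝ) * coherence n p X) * R ≤ n * (R / 4) := by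
      rw [mul_assoc]
      refine mul_le_mul_of_nonneg_left ?_ hn'.le
      nlinarith
    have h3 : n * (βplus j + dplus j - βdag j) =
        ∑ k, X k j * η k - (∑ k, X k j * X.mulVec r k - n * r j) := by
      rw [mul_sub, mul_add, ← hresid j, hy, hr, mulVec_sub]
      simp only [Pi.sub_apply, Pi.add_apply, mul_sub, mul_add, Finset.sum_sub_distrib,
        Finset.sum_add_distrib]
      ring
    have h4 : n * |βplus j + dplus j - βdag j| ≤ n * (lamu + R / 4) := by
      rw [← abs_of_pos hn', ← abs_mul, abs_of_pos hn', h3]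
      refine (abs_sub _ _).trans ?_
      linarith [hnoise j]
    exact le_of_mul_le_mul_left h4 hn'
  have hbound : ∀ K, |βdag istar| ≤ K → lam / 10 + K / 4 ≤ K → ∀ i, |r i| ≤ K := by
    intro K hM hK
    obtain ⟨m, -, hm⟩ :=
      Finset.exists_max_image Finset.univ (fun i => |r i|) ⟨istar, Finset.mem_univ _⟩
    have hm' : ∀ i, |r i| ≤ |r m| := fun i => hm i (Finset.mem_univ i)
    refine fun i => (hm' i).trans ?_
    by_cases hmA : m ∈ A
    · have h1 := herr _ hm' m
      have h2 : |dplus m| = lam / 10 - 3 * lamu := by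
        rw [hdA m hmA, hlambar]
        rcases hs m hmA with h | h <;> rw [h, abs_mul] <;> norm_num <;>
          rw [abs_of_pos (by linarith)] <;> ring
      have h3 : |r m| ≤ |βplus m + dplus m - βdag m| + |dplus m| := by
        have : r m = (βplus m + dplus m - βdag m) - dplus m := by
          simp only [hr, Pi.sub_apply]
          ring
        rw [this]
        exact abs_sub _ _
      linarith
    · by_cases h0 : βdag m = 0
      · simpa [hr, h0, hout m hmA] using (abs_nonneg _).trans hM
      · have := histar3 m h0 hmA
        simp only [hr, Pi.sub_apply, hout m hmA, zero_sub, abs_neg]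
        linarith
  have hlow : ∀ j, |βdag j| ≤ |βplus j + dplus j| + |βplus j + dplus j - βdag j| := by
    intro j
    have := abs_sub (βplus j + dplus j) (βplus j + dplus j - βdag j)
    rwa [sub_sub_cancel] at this
  refine ⟨fun τ hτ hsub => ?_, fun hsub1 hsub2 _ i hi hinot => ?_⟩
  · have hM : |βdag istar| < lam * τ := by
      by_contra h
      exact histar2 (hsub (not_lt.1 h))
    have hτ1 : 8 / 5 ≤ τ := by rcases hτ with h | h <;> rw [h]; norm_num
    have hτ2 : τ ≤ 13 / 5 := by rcases hτ with h | h <;> rw [h] <;> norm_num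
    have hlamτ1 : lam * (8 / 5) ≤ lam * τ := mul_le_mul_of_nonneg_left hτ1 (by linarith)
    have hlamτ2 : lam * τ ≤ lam * (13 / 5) := mul_le_mul_of_nonneg_left hτ2 (by linarith)
    have hE := herr _ (hbound (lam * τ) hM.le (by linarith))
    constructor
    · intro j hj
      simp only [Set.mem_ofPred_eq] at hj ⊢
      linarith [hlow j, hE j]
    · intro j hj h0
      simp only [Set.mem_ofPred_eq] at hj
      have := hE j
      rw [h0, sub_zero] at this
      linarith
  · obtain ⟨m, hm, hmA⟩ := Set.not_subset.1 hsub2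
    simp only [Set.mem_ofPred_eq] at hm
    have hm0 : βdag m ≠ 0 := by
      intro h
      rw [h, abs_zero] at hm
      linarith
    have hM := hm.trans (histar3 m hm0 hmA)
    have hE := herr _ (hbound _ le_rfl (by linarith)) i
    linarith [hlow i, not_lt.1 hinot]
end

section
/- Let y = Xβ† + η with X ∈ ℝ^{n×p} (p ≥ 2) √n-normalized and with mutual coherence ν; let A† = supp(β†), T = |A†| ≥ 1, and assume Tν ≤ 1/4 and ‖Xᵀη‖_∞ ≤ n λ_u for some λ_u > 0. Set δ_u = 3λ_u and let λ satisfy 10 δ_u < λ ≤ (65/4) δ_u, with shift λ̄ = (9/10)λ + δ_u. Suppose β̂ ∈ ℝ^p satisfies β̂_j = 0 for all j ∉ A† and β̂_{A†} = (X_{A†}ᵀ X_{A†})^{-1}(X_{A†}ᵀ y − n d) for some d ∈ ℝ^{|A†|} with ‖d‖_∞ ≤ λ − λ̄. Then ‖β̂ − β†‖_∞ < (23/6) λ_u; moreover, if in addition min_{j∈A†} |β†_j| ≥ 78 λ_u, then sgn(β̂_j) = sgn(β†_j) for every j ∈ {1, …, p} (sign consistency). -/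
open scoped BigOperators
open Matrix

attribute [local instance] Classical.propDecidable

theorem abs_inner_le_coherence (n p : ℕ) (hn : 0 < n) (X : Matrix (Fin n) (Fin p) ℝ)
    {i j : Fin p} (hij : i ≠ j) : |∑ k, X k i * X k j| ≤ n * coherence n p X := by
  have hn' : (0 : ℝ) < n := by exact_mod_cast hn
  rw [mul_comm, ← div_le_iff₀ hn']
  refine le_csSup ?_ ⟨i, j, hij, rfl⟩
  refine ((Set.finite_range fun q : Fin p × Fin p =>
    |∑ k, X k q.1 * X k q.2| / (n : ℝ)).subset ?_).bddAbove
  rintro r ⟨i, j, -, rfl⟩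
  exact ⟨(i, j), rfl⟩

section NearlyDiagonal

variable {ι : Type*} [Fintype ι] [DecidableEq ι] {G : Matrix ι ι ℝ} {a m : ℝ}

theorem sum_erase_abs_le (hoff : ∀ i j, i ≠ j → |G i j| ≤ m) (i : ι) :
    ∑ j ∈ Finset.univ.erase i, |G i j| ≤ ((Fintype.card ι : ℝ) - 1) * m := by
  have hcard : ((Finset.univ.erase i).card : ℝ) = (Fintype.card ι : ℝ) - 1 := by
    rw [Finset.cast_card_erase_of_mem (Finset.mem_univ i), Finset.card_univ]
  rw [← hcard, ← nsmul_eq_mul]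
  exact Finset.sum_le_card_nsmul _ _ _ fun j hj => hoff i j (Finset.ne_of_mem_erase hj).symm

theorem det_ne_zero_of_card_mul_lt_diag (hdiag : ∀ i, G i i = a)
    (hoff : ∀ i j, i ≠ j → |G i j| ≤ m) (hdom : ((Fintype.card ι : ℝ) - 1) * m < a) :
    G.det ≠ 0 := by
  refine det_ne_zero_of_sum_row_lt_diag fun i => ?_
  simp only [Real.norm_eq_abs, hdiag]
  exact ((sum_erase_abs_le hoff i).trans_lt hdom).trans_le (le_abs_self a)

theorem abs_mul_le_of_abs_mulVec_le (hdiag : ∀ i, G i i = a)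
    (hoff : ∀ i j, i ≠ j → |G i j| ≤ m) (hdom : ((Fintype.card ι : ℝ) - 1) * m < a)
    {v : ι → ℝ} {b : ℝ} (hv : ∀ i, |(G *ᵥ v) i| ≤ b) (i : ι) :
    (a - ((Fintype.card ι : ℝ) - 1) * m) * |v i| ≤ b := by
  have : Nonempty ι := ⟨i⟩
  obtain ⟨j, hj⟩ := Finite.exists_max fun k => |v k|
  have hsplit : (G *ᵥ v) j = a * v j + ∑ k ∈ Finset.univ.erase j, G j k * v k := by
    rw [mulVec, dotProduct, ← Finset.add_sum_erase _ _ (Finset.mem_univ j), hdiag]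
  have hrest : |∑ k ∈ Finset.univ.erase j, G j k * v k| ≤
      ((Fintype.card ι : ℝ) - 1) * m * |v j| := by
    calc |∑ k ∈ Finset.univ.erase j, G j k * v k|
        ≤ ∑ k ∈ Finset.univ.erase j, |G j k| * |v j| := by
          refine (Finset.abs_sum_le_sum_abs _ _).trans (Finset.sum_le_sum fun k _ => ?_)
          rw [abs_mul]
          exact mul_le_mul_of_nonneg_left (hj k) (abs_nonneg _)
      _ ≤ _ := by
          rw [← Finset.sum_mul]
          exact mul_le_mul_of_nonneg_right (sum_erase_abs_le hoff j) (abs_nonneg _)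
  have hmain : a * |v j| ≤ b + ((Fintype.card ι : ℝ) - 1) * m * |v j| := by
    calc a * |v j| ≤ |a * v j| := by
          rw [abs_mul]
          exact mul_le_mul_of_nonneg_right (le_abs_self a) (abs_nonneg _)
      _ = |(G *ᵥ v) j - ∑ k ∈ Finset.univ.erase j, G j k * v k| := by rw [hsplit]; ring_nf
      _ ≤ |(G *ᵥ v) j| + |∑ k ∈ Finset.univ.erase j, G j k * v k| := abs_sub _ _
      _ ≤ _ := add_le_add (hv j) hrest
  calc (a - ((Fintype.card ι : ℝ) - 1) * m) * |v i|
      ≤ (a - ((Fintype.card ι : ℝ) - 1) * m) * |v j| :=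
        mul_le_mul_of_nonneg_left (hj i) (sub_pos.2 hdom).le
    _ ≤ b := by linarith

end NearlyDiagonal

theorem sign_eq_sign_of_abs_sub_lt {x y : ℝ} (h : |x - y| < |y|) :
    Real.sign x = Real.sign y := by
  rcases lt_trichotomy y 0 with hy | rfl | hy
  · rw [abs_of_neg hy, abs_lt] at h
    rw [Real.sign_of_neg hy, Real.sign_of_neg (by linarith)]
  · rw [abs_zero] at h
    exact absurd h (abs_nonneg _).not_gt
  · rw [abs_of_pos hy, abs_lt] at h
    rw [Real.sign_of_pos hy, Real.sign_of_pos (by linarith)]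

/-- The normal equations on a set containing the support. -/
theorem gram_mulVec_restrict {n p : ℕ} (X : Matrix (Fin n) (Fin p) ℝ) (β : Fin p → ℝ)
    (A : Finset (Fin p)) (hA : ∀ j, j ∉ A → β j = 0) (j : A) :
    (((X.submatrix id (fun j' : A => (j' : Fin p)))ᵀ *
      (X.submatrix id (fun j' : A => (j' : Fin p)))) *ᵥ fun k : A => β k) j =
      ∑ i, X i j * (X *ᵥ β) i := by
  have hmul : (X.submatrix id (fun j' : A => (j' : Fin p))) *ᵥ (fun k : A => β k) = X *ᵥ β := by
    ext i
    simp only [mulVec, dotProduct, submatrix_apply, id_eq]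
    rw [Finset.sum_coe_sort A fun k => X i k * β k]
    refine Finset.sum_subset (Finset.subset_univ A) fun k _ hk => ?_
    rw [hA k hk, mul_zero]
  rw [← mulVec_mulVec, hmul]
  rfl

/-- error bound and sign consistency. Under Tν ≤ 1/4, the noise bound
‖Xᵀη‖_∞ ≤ nλ_u, 10δ_u < λ ≤ (65/4)δ_u and λ̄ = (9/10)λ + δ_u, any β̂ supported on A†
with β̂_{A†} = (X_{A†}ᵀX_{A†})⁻¹(X_{A†}ᵀy − nd), ‖d‖_∞ ≤ λ − λ̄, satisfies
‖β̂ − β†‖_∞ < (23/6)λ_u; and if min_{j∈A†}|β†_j| ≥ 78λ_u then sgn(β̂) = sgn(β†). -/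
theorem stmt_19 (n p : ℕ) (hn : 0 < n) (hp : 2 ≤ p)
    (X : Matrix (Fin n) (Fin p) ℝ) (hX : ∀ j, ∑ k, X k j ^ 2 = (n : ℝ))
    (βdag : Fin p → ℝ) (η : Fin n → ℝ)
    (lamu : ℝ) (hlamu : 0 < lamu)
    (hnoise : ∀ j, |∑ i, X i j * η i| ≤ (n : ℝ) * lamu)
    (hT : 1 ≤ (Finset.filter (fun j => βdag j ≠ 0) Finset.univ).card)
    (hA1 : ((Finset.filter (fun j => βdag j ≠ 0) Finset.univ).card : ℝ) *
      coherence n p X ≤ 1 / 4)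
    (lam : ℝ) (hlam1 : 10 * (3 * lamu) < lam) (hlam2 : lam ≤ (65 / 4) * (3 * lamu))
    (lambar : ℝ) (hlambar : lambar = (9 / 10) * lam + 3 * lamu)
    (y : Fin n → ℝ) (hy : y = X.mulVec βdag + η)
    (Adag : Finset (Fin p)) (hAdag : Adag = Finset.filter (fun j => βdag j ≠ 0) Finset.univ)
    (d : ↥Adag → ℝ) (hd : ∀ j : ↥Adag, |d j| ≤ lam - lambar)
    (βhat : Fin p → ℝ)
    (hβhat0 : ∀ j, βdag j = 0 → βhat j = 0)
    (hβhatA : ∀ j : ↥Adag, βhat (j : Fin p) =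
      (((X.submatrix id (fun j' : ↥Adag => (j' : Fin p)))ᵀ *
          (X.submatrix id (fun j' : ↥Adag => (j' : Fin p))))⁻¹.mulVec
        (fun j' : ↥Adag => (∑ i, X i (j' : Fin p) * y i) - (n : ℝ) * d j')) j) :
    ‖βhat - βdag‖ < (23 / 6) * lamu ∧
    ((∀ j, βdag j ≠ 0 → 78 * lamu ≤ |βdag j|) →
      ∀ j, Real.sign (βhat j) = Real.sign (βdag j)) := by
  have hn' : (0 : ℝ) < n := by exact_mod_cast hn
  have hA : ∀ j, j ∈ Adag ↔ βdag j ≠ 0 := by simp [hAdag]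
  rw [← hAdag] at hA1
  have hν := coherence_nonneg n p X
  have hslack : ((Adag.card : ℝ) - 1) * coherence n p X < 1 / 4 := by
    rcases hν.eq_or_lt with h | h
    · rw [← h]; norm_num
    · linarith
  set G := (X.submatrix id (fun j' : ↥Adag => (j' : Fin p)))ᵀ *
    (X.submatrix id (fun j' : ↥Adag => (j' : Fin p))) with hG
  have hGapp : ∀ i j : Adag, G i j = ∑ k, X k i * X k j := fun i j => rfl
  have hdiag : ∀ i, G i i = (n : ℝ) := fun i => by
    rw [hGapp, ← hX i]
    exact Finset.sum_congr rfl fun k _ => (sq _).symm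
  have hoff : ∀ i j, i ≠ j → |G i j| ≤ n * coherence n p X := fun i j hij =>
    abs_inner_le_coherence n p hn X fun h => hij (Subtype.ext h)
  have hgap : (n : ℝ) * (3 / 4) <
      n - ((Fintype.card Adag : ℝ) - 1) * (n * coherence n p X) := by
    rw [Fintype.card_coe]
    nlinarith
  have hdom : ((Fintype.card Adag : ℝ) - 1) * (n * coherence n p X) < n := by linarith
  have hunit : IsUnit G.det := (det_ne_zero_of_card_mul_lt_diag hdiag hoff hdom).isUnit
  have hres : ∀ j : Adag, (G *ᵥ fun k : Adag => βhat k - βdag k) j =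
      ∑ i, X i j * η i - n * d j := by
    intro j
    have hhat : (fun k : Adag => βhat k) =
        G⁻¹ *ᵥ fun j' : Adag => (∑ i, X i j' * y i) - (n : ℝ) * d j' := funext hβhatA
    have hdag := gram_mulVec_restrict X βdag Adag (fun j hj => by simpa [hA] using hj) j
    rw [← hG] at hdag
    change (G *ᵥ ((fun k : Adag => βhat k) - fun k : Adag => βdag k)) j = _
    rw [mulVec_sub, Pi.sub_apply, hdag, hhat, mulVec_mulVec, mul_nonsing_inv G hunit,
      one_mulVec, hy]
    simp only [Pi.add_apply, mul_add, Finset.sum_add_distrib]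
    ring
  have hbound : ∀ j : Adag, |(G *ᵥ fun k : Adag => βhat k - βdag k) j| ≤
      n * (23 / 8 * lamu) := by
    intro j
    have hdj : |(n : ℝ) * d j| ≤ n * (15 / 8 * lamu) := by
      rw [abs_mul, abs_of_pos hn']
      exact mul_le_mul_of_nonneg_left ((hd j).trans (by linarith)) hn'.le
    rw [hres]
    linarith [abs_sub (∑ i, X i j * η i) (n * d j), hnoise j]
  have herr : ∀ j, |βhat j - βdag j| < 23 / 6 * lamu := by
    intro j
    by_cases hj : βdag j = 0
    · rw [hβhat0 j hj, hj, sub_zero, abs_zero]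
      positivity
    · have h := abs_mul_le_of_abs_mulVec_le hdiag hoff hdom hbound ⟨j, (hA j).2 hj⟩
      by_contra! hlt
      have hpos : 0 < |βhat j - βdag j| := lt_of_lt_of_le (by positivity) hlt
      have h₁ := mul_lt_mul_of_pos_right hgap hpos
      have h₂ := mul_le_mul_of_nonneg_left hlt hn'.le
      linarith
  refine ⟨(pi_norm_lt_iff (by positivity)).2 fun j => herr j, fun hmin j => ?_⟩
  by_cases hj : βdag j = 0
  · rw [hβhat0 j hj, hj]
  · exact sign_eq_sign_of_abs_sub_lt (by linarith [herr j, hmin j hj])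
end
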